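/- arXiv:0906.5023 — 2 statements merged into one kernel-verified Lean document; each statement's English description precedes it below -/
import Mathlib

section
/- Let k be an integer with 1 ≤ k ≤ 6 and let C be a Type II ℤ_{2k}-code of length n. Then the minimum Euclidean weight of C satisfies d_E(C) ≤ 4k·⌊n/24⌋ + 4k. -/
open scoped BigOperators

/-- Euclidean weight of a word over `ℤ/mℤ`. -/
def euclWt {m : ℕ} {ι : Type*} [Fintype ι] (x : ι → ZMod m) : ℕ :=
  ∑ i, min ((x i).val ^ 2) ((m - (x i).val) ^ 2)

/-- The dual code under the standard inner product. -/
def dualCode {m : ℕ} {ι : Type*} [Fintype ι]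
    (C : Submodule (ZMod m) (ι → ZMod m)) : Set (ι → ZMod m) :=
  {x | ∀ y ∈ C, ∑ i, x i * y i = 0}

/-- A code is self-dual if it coincides with its dual code. -/
def IsSelfDualCode {m : ℕ} {ι : Type*} [Fintype ι]
    (C : Submodule (ZMod m) (ι → ZMod m)) : Prop :=
  (C : Set (ι → ZMod m)) = dualCode C

/-- A Type II `ℤ_{2k}`-code: self-dual with all Euclidean weights divisible by `4k`. -/
def IsTypeII (k : ℕ) {ι : Type*} [Fintype ι]
    (C : Submodule (ZMod (2 * k)) (ι → ZMod (2 * k))) : Prop :=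
  IsSelfDualCode C ∧ ∀ c ∈ C, 4 * k ∣ euclWt c

/-- The minimum Euclidean weight of a code. -/
noncomputable def minEuclWt {m : ℕ} {ι : Type*} [Fintype ι]
    (C : Submodule (ZMod m) (ι → ZMod m)) : ℕ :=
  sInf {w | ∃ c ∈ C, c ≠ 0 ∧ euclWt c = w}

/-- Standard inner product on `ι → ℝ`. -/
def ip {ι : Type*} [Fintype ι] (x y : ι → ℝ) : ℝ := ∑ i, x i * y i

/-- A lattice: a discrete `ℤ`-submodule of `ℝ^ι` spanning it over `ℝ`. -/
def IsLatticeIn {ι : Type*} [Fintype ι] (L : Submodule ℤ (ι → ℝ)) : Prop :=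
  DiscreteTopology L ∧ Submodule.span ℝ (L : Set (ι → ℝ)) = ⊤

/-- The dual lattice. -/
def dualLattice {ι : Type*} [Fintype ι] (L : Submodule ℤ (ι → ℝ)) : Set (ι → ℝ) :=
  {x | ∀ y ∈ L, ∃ z : ℤ, ip x y = (z : ℝ)}

/-- A lattice is unimodular if it equals its dual. -/
def IsUnimodularLattice {ι : Type*} [Fintype ι] (L : Submodule ℤ (ι → ℝ)) : Prop :=
  (L : Set (ι → ℝ)) = dualLattice L

/-- A lattice is even if every vector has even integral norm. -/
def IsEvenLattice {ι : Type*} [Fintype ι] (L : Submodule ℤ (ι → ℝ)) : Prop :=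
  ∀ x ∈ L, ∃ z : ℤ, ip x x = 2 * (z : ℝ)

/-- `r` is the minimum norm of the lattice `L`. -/
def HasMinNorm {ι : Type*} [Fintype ι] (L : Submodule ℤ (ι → ℝ)) (r : ℝ) : Prop :=
  IsLeast {t : ℝ | ∃ x ∈ L, x ≠ 0 ∧ ip x x = t} r

/-- Construction A: the set `(1/√m)·{x ∈ ℤ^ι : (x mod m) ∈ C}`. -/
def constructionA (m : ℕ) {ι : Type*} [Fintype ι] (C : Set (ι → ZMod m)) :
    Set (ι → ℝ) :=
  {v | ∃ x : ι → ℤ, (fun i => (x i : ZMod m)) ∈ C ∧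
    v = fun i => (x i : ℝ) / Real.sqrt m}

/-- A negacirculant matrix. -/
def IsNegacirculant {m : ℕ} {R : Type*} [CommRing R] (A : Matrix (Fin m) (Fin m) R) : Prop :=
  ∃ r : Fin m → R, ∀ i j : Fin m,
    A i j = if h : (i : ℕ) ≤ (j : ℕ) then r ⟨(j : ℕ) - (i : ℕ), by have := j.isLt; omega⟩
      else - r ⟨m + (j : ℕ) - (i : ℕ), by have := i.isLt; have := j.isLt; omega⟩

open PowerSeries in
theorem PowerSeries.coeff_mul_nonneg {A B : ℝ⟦X⟧} (hA : ∀ n, 0 ≤ coeff n A)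
    (hB : ∀ n, 0 ≤ coeff n B) (n : ℕ) : 0 ≤ coeff n (A * B) := by
  rw [coeff_mul]
  exact Finset.sum_nonneg fun p _ => mul_nonneg (hA _) (hB _)

open PowerSeries in
theorem PowerSeries.coeff_pow_nonneg {A : ℝ⟦X⟧} (hA : ∀ n, 0 ≤ coeff n A) (d n : ℕ) :
    0 ≤ coeff n (A ^ d) := by
  induction d generalizing n with
  | zero =>
    rw [pow_zero, coeff_one]
    split_ifs <;> norm_num
  | succ d ih =>
    rw [pow_succ]
    exact coeff_mul_nonneg ih hA n

open PowerSeries in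
theorem PowerSeries.coeff_prod_nonneg {ι : Type*} (S : Finset ι) {A : ι → ℝ⟦X⟧}
    (hA : ∀ i ∈ S, ∀ n, 0 ≤ coeff n (A i)) (n : ℕ) : 0 ≤ coeff n (∏ i ∈ S, A i) := by
  classical
  induction S using Finset.induction_on generalizing n with
  | empty =>
    rw [Finset.prod_empty, coeff_one]
    split_ifs <;> norm_num
  | insert i S hi ih =>
    rw [Finset.prod_insert hi]
    exact coeff_mul_nonneg (hA i (by simp))
      (ih fun j hj => hA j (Finset.mem_insert_of_mem hj)) n

/-- Growth by a factor `r` of consecutive coefficients is preserved by multiplication with a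
power series with nonnegative coefficients. -/
theorem PowerSeries.coeff_mul_growth {A V : PowerSeries ℝ} {r : ℝ} {N : ℕ}
    (hA0 : 0 ≤ coeff 0 A) (hA : ∀ n < N, r * coeff n A ≤ coeff (n + 1) A)
    (hV : ∀ n, 0 ≤ coeff n V) (n : ℕ) (hn : n < N) :
    r * coeff n (A * V) ≤ coeff (n + 1) (A * V) := by
  rw [coeff_mul, coeff_mul, Finset.Nat.sum_antidiagonal_succ, Finset.mul_sum]
  have h : ∑ p ∈ Finset.HasAntidiagonal.antidiagonal n, r * (coeff p.1 A * coeff p.2 V) ≤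
      ∑ p ∈ Finset.HasAntidiagonal.antidiagonal n, coeff (p.1 + 1) A * coeff p.2 V := by
    refine Finset.sum_le_sum fun p hp => ?_
    rw [← mul_assoc]
    have := Finset.HasAntidiagonal.mem_antidiagonal.1 hp
    exact mul_le_mul_of_nonneg_right (hA _ (by omega)) (hV _)
  have h2 := mul_nonneg hA0 (hV (n + 1))
  simpa using h.trans (le_add_of_nonneg_left h2)

theorem PowerSeries.coeff_geometric_pow_growth (s n : ℕ) (hn : n < s) :
    24 * coeff n ((mk 1 : PowerSeries ℝ) ^ (24 * s)) ≤
      coeff (n + 1) ((mk 1 : PowerSeries ℝ) ^ (24 * s)) := by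
  obtain ⟨d, hd⟩ : ∃ d, 24 * s = d + 1 := ⟨24 * s - 1, by omega⟩
  rw [hd, mk_one_pow_eq_mk_choose_add, coeff_mk, coeff_mk]
  have h : (d + n + 1) * (d + n).choose d = (d + (n + 1)).choose d * (n + 1) := by
    have := Nat.add_one_mul_choose_eq (d + n) n
    rw [Nat.choose_symm_add, show d + (n + 1) = d + n + 1 by ring,
      Nat.choose_symm_of_eq_add (show d + n + 1 = d + (n + 1) by ring)]
    exact this
  have h2 : 24 * (n + 1) * (d + n).choose d ≤ (d + (n + 1)).choose d * (n + 1) := by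
    rw [← h]
    exact Nat.mul_le_mul_right _ (by omega)
  have h3 : 24 * (d + n).choose d ≤ (d + (n + 1)).choose d := by
    refine Nat.le_of_mul_le_mul_right (c := n + 1) ?_ (by omega)
    linarith
  exact_mod_cast h3

/-- The `q`-expansion of the normalised Eisenstein series of weight four, over `ℝ`. -/
noncomputable def eisensteinFourSeries : PowerSeries ℝ :=
  .mk fun n => if n = 0 then 1 else 240 * (ArithmeticFunction.sigma 3 n : ℝ)

theorem eisensteinFourSeries_coeff_nonneg (n : ℕ) :
    0 ≤ PowerSeries.coeff n eisensteinFourSeries := by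
  rw [eisensteinFourSeries, PowerSeries.coeff_mk]
  split_ifs <;> positivity

theorem eisensteinFourSeries_coeff_le (n : ℕ) :
    PowerSeries.coeff n eisensteinFourSeries ≤ 34 * 8 ^ n := by
  rw [eisensteinFourSeries, PowerSeries.coeff_mk]
  match n with
  | 0 => norm_num
  | 1 => norm_num
  | 2 => norm_num [show ArithmeticFunction.sigma 3 2 = 9 from rfl]
  | 3 => norm_num [show ArithmeticFunction.sigma 3 3 = 28 from rfl]
  | m + 4 =>
    have h1 : ArithmeticFunction.sigma 3 (m + 4) ≤ (m + 4) ^ 4 :=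
      ArithmeticFunction.sigma_le_pow_succ 3 (m + 4)
    have h2 : 240 * (m + 4) ^ 4 ≤ 34 * 8 ^ (m + 4) := by
      induction m with
      | zero => norm_num
      | succ m ih =>
        have h3 : (m + 5) ^ 4 ≤ 8 * (m + 4) ^ 4 := by
          have : (m + 5) ^ 4 ≤ 8 * (m + 4) ^ 4 := by
            ring_nf
            nlinarith [Nat.zero_le (m ^ 4), Nat.zero_le (m ^ 3), Nat.zero_le (m ^ 2)]
          exact this
        calc 240 * (m + 1 + 4) ^ 4 = 240 * (m + 5) ^ 4 := by ring
          _ ≤ 8 * (240 * (m + 4) ^ 4) := by linarith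
          _ ≤ 8 * (34 * 8 ^ (m + 4)) := Nat.mul_le_mul_left _
            (ih (ArithmeticFunction.sigma_le_pow_succ 3 (m + 4)))
          _ = 34 * 8 ^ (m + 1 + 4) := by ring
    rw [if_neg (by omega)]
    exact_mod_cast (Nat.mul_le_mul_left 240 h1).trans h2

theorem sum_antidiagonal_succ_mul_eight_pow (m : ℕ) :
    49 * ∑ p ∈ Finset.HasAntidiagonal.antidiagonal m, ((p.1 : ℝ) + 1) * 8 ^ p.2 = 8 ^ (m + 2) - 7 * m - 15 := by
  induction m with
  | zero => norm_num
  | succ m ih =>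
    rw [Finset.Nat.sum_antidiagonal_succ']
    have : ∑ p ∈ Finset.HasAntidiagonal.antidiagonal m, ((p.1 : ℝ) + 1) * 8 ^ (p.2 + 1) =
        8 * ∑ p ∈ Finset.HasAntidiagonal.antidiagonal m, ((p.1 : ℝ) + 1) * 8 ^ p.2 := by
      rw [Finset.mul_sum]
      exact Finset.sum_congr rfl fun p _ => by ring
    rw [this]
    push_cast
    rw [mul_add, mul_left_comm 49 8, ih]
    ring

section Positivity

open PowerSeries

variable {G : ℝ⟦X⟧}

theorem coeff_bracket_ge (hg0 : coeff 0 G = 1) (hg : ∀ n, 0 ≤ coeff n G) (m : ℕ) :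
    coeff (m + 1) eisensteinFourSeries * (m + 1) - 8 * coeff m (d⁄dX ℝ G * eisensteinFourSeries) ≤
      coeff m (G * d⁄dX ℝ eisensteinFourSeries - 8 * (d⁄dX ℝ G * eisensteinFourSeries)) := by
  rw [map_sub, show (8 : ℝ⟦X⟧) = C (8 : ℝ) from rfl, coeff_C_mul]
  refine sub_le_sub_right ?_ _
  rw [coeff_mul]
  have h := Finset.single_le_sum (s := Finset.HasAntidiagonal.antidiagonal m) (a := (0, m))
    (f := fun p => coeff p.1 G * coeff p.2 (d⁄dX ℝ eisensteinFourSeries))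
    (fun p _ => mul_nonneg (hg _) (by
      rw [coeff_derivative]
      exact mul_nonneg (eisensteinFourSeries_coeff_nonneg _) (by positivity))) (by simp)
  simpa [hg0, coeff_derivative] using h

theorem coeff_derivative_mul_eisenstein_le (hg2 : ∀ n, coeff n G ≤ 2) (m : ℕ) :
    8 * coeff m (d⁄dX ℝ G * eisensteinFourSeries) ≤ 711 * 8 ^ m := by
  rw [coeff_mul]
  have h : ∑ p ∈ Finset.HasAntidiagonal.antidiagonal m,
      coeff p.1 (d⁄dX ℝ G) * coeff p.2 eisensteinFourSeries ≤
      ∑ p ∈ Finset.HasAntidiagonal.antidiagonal m, 68 * (((p.1 : ℝ) + 1) * 8 ^ p.2) := by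
    refine Finset.sum_le_sum fun p _ => ?_
    rw [coeff_derivative]
    have h1 := eisensteinFourSeries_coeff_nonneg p.2
    have h2 := eisensteinFourSeries_coeff_le p.2
    calc coeff (p.1 + 1) G * ((p.1 : ℝ) + 1) * coeff p.2 eisensteinFourSeries
        ≤ 2 * ((p.1 : ℝ) + 1) * coeff p.2 eisensteinFourSeries := by
          gcongr
          exact hg2 _
      _ ≤ 2 * ((p.1 : ℝ) + 1) * (34 * 8 ^ p.2) := by gcongr
      _ = _ := by ring
  rw [← Finset.mul_sum] at h
  have h3 := sum_antidiagonal_succ_mul_eight_pow m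
  have h4 : (0 : ℝ) < 8 ^ m := by positivity
  have h5 : (0 : ℝ) ≤ m := by positivity
  rw [pow_add] at h3
  linarith

theorem coeff_bracket_lower (hg0 : coeff 0 G = 1) (hg : ∀ n, 0 ≤ coeff n G)
    (hg2 : ∀ n, coeff n G ≤ 2) (m : ℕ) :
    (if m = 0 then 935 else 0) + (if m = 1 then 5688 else 0) - 711 * 8 ^ m ≤
      coeff m (G * d⁄dX ℝ eisensteinFourSeries - 8 * (d⁄dX ℝ G * eisensteinFourSeries)) := by
  refine le_trans ?_ (coeff_bracket_ge hg0 hg m)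
  match m with
  | 0 =>
    have h1 := hg2 1
    have h2 : constantCoeff (d⁄dX ℝ G) = coeff 1 G := by
      rw [← coeff_zero_eq_constantCoeff_apply, coeff_derivative]
      simp
    simp [eisensteinFourSeries, h2]
    linarith
  | 1 =>
    have h1 := hg2 1
    have h2 := hg2 2
    have : coeff 1 (d⁄dX ℝ G * eisensteinFourSeries) = coeff 1 G * 240 + coeff 2 G * 2 := by
      rw [coeff_mul, Finset.Nat.sum_antidiagonal_succ]
      norm_num [eisensteinFourSeries, coeff_derivative]
    rw [this, eisensteinFourSeries, coeff_mk]
    norm_num [show ArithmeticFunction.sigma 3 2 = 9 from rfl]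
    linarith
  | m + 2 =>
    have h1 := coeff_derivative_mul_eisenstein_le hg2 (m + 2)
    have h2 := mul_nonneg (eisensteinFourSeries_coeff_nonneg (m + 2 + 1))
      (by positivity : (0 : ℝ) ≤ ((m + 2 : ℕ) : ℝ) + 1)
    simp only [Nat.add_eq_zero_iff, OfNat.ofNat_ne_zero, and_false, if_false,
      show m + 2 ≠ 1 by omega]
    linarith

theorem coeff_bracket_mul_pos (hg0 : coeff 0 G = 1) (hg : ∀ n, 0 ≤ coeff n G)
    (hg2 : ∀ n, coeff n G ≤ 2) {A : ℝ⟦X⟧} (hA0 : 0 < coeff 0 A) {N : ℕ}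
    (hA : ∀ n < N, 24 * coeff n A ≤ coeff (n + 1) A) :
    0 < coeff N ((G * d⁄dX ℝ eisensteinFourSeries -
      8 * (d⁄dX ℝ G * eisensteinFourSeries)) * A) := by
  set B := G * d⁄dX ℝ eisensteinFourSeries - 8 * (d⁄dX ℝ G * eisensteinFourSeries) with hB
  have hb := coeff_bracket_lower hg0 hg hg2
  rw [← hB] at hb
  have hApos : ∀ n ≤ N, 0 < coeff n A := by
    intro n
    induction n with
    | zero => exact fun _ => hA0
    | succ n ih =>
      intro hn
      have := ih (by omega)
      linarith [hA n (by omega)]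
  have hratio : ∀ m ≤ N, 24 ^ m * coeff (N - m) A ≤ coeff N A := by
    intro m
    induction m with
    | zero => simp
    | succ m ih =>
      intro hm
      have h1 := hA (N - (m + 1)) (by omega)
      rw [show N - (m + 1) + 1 = N - m by omega] at h1
      refine le_trans ?_ (ih (by omega))
      rw [pow_succ, mul_assoc]
      exact mul_le_mul_of_nonneg_left h1 (by positivity)
  rw [coeff_mul, Finset.Nat.sum_antidiagonal_eq_sum_range_succ
    (fun i j => coeff i B * coeff j A)]
  have hc := hApos N le_rfl
  rcases Nat.eq_zero_or_pos N with rfl | hN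
  · have := hb 0
    norm_num at this
    simp only [Finset.sum_range_one]
    have h0 : 0 < coeff 0 B := by
      rw [coeff_zero_eq_constantCoeff_apply]
      linarith
    exact mul_pos h0 hc
  have hterm : ∀ m ∈ Finset.range (N + 1),
      coeff N A * ((if m = 0 then 935 else 0) + (if m = 1 then 237 else 0) - 711 * (1 / 3) ^ m) ≤
        coeff m B * coeff (N - m) A := by
    intro m hm
    have hm' : m ≤ N := by
      have := Finset.mem_range.1 hm
      omega
    have h1 := hApos (N - m) (by omega)
    have h2 := hratio m hm'
    match m, hm' with
    | 0, _ =>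
      have := hb 0
      norm_num at this ⊢
      nlinarith
    | 1, _ =>
      have := hb 1
      norm_num at this ⊢
      exact mul_nonneg this h1.le
    | m + 2, _ =>
      have h3 := hb (m + 2)
      simp only [Nat.add_eq_zero_iff, OfNat.ofNat_ne_zero, and_false, if_false,
        show m + 2 ≠ 1 by omega, zero_add, zero_sub] at h3 ⊢
      have h4 : (8 : ℝ) ^ (m + 2) * coeff (N - (m + 2)) A ≤ coeff N A * (1 / 3) ^ (m + 2) := by
        have h5 : (24 : ℝ) ^ (m + 2) * (1 / 3) ^ (m + 2) = 8 ^ (m + 2) := by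
          rw [← mul_pow]
          norm_num
        rw [← h5, mul_right_comm]
        exact mul_le_mul_of_nonneg_right h2 (by positivity)
      have h6 := mul_le_mul_of_nonneg_right h3 h1.le
      linarith
  refine lt_of_lt_of_le ?_ (Finset.sum_le_sum hterm)
  rw [← Finset.mul_sum]
  refine mul_pos hc ?_
  rw [Finset.sum_sub_distrib, Finset.sum_add_distrib, ← Finset.mul_sum,
    Finset.sum_ite_eq' , Finset.sum_ite_eq', geom_sum_eq (by norm_num)]
  have : (0 : ℝ) < (1 / 3) ^ (N + 1) := by positivity
  rw [if_pos (by simp), if_pos (by simpa using hN),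
    show (((1 : ℝ) / 3) ^ N.succ - 1) / (1 / 3 - 1) = 3 / 2 * (1 - (1 / 3) ^ (N + 1)) by
      rw [Nat.succ_eq_add_one]
      ring]
  linarith

end Positivity

section Residue

open PowerSeries

variable {K : Type*} [Field K]

theorem PowerSeries.derivative_of_mul_eq_one {v w : K⟦X⟧} (h : v * w = 1) :
    d⁄dX K v = -(v ^ 2 * d⁄dX K w) := by
  have h1 := congrArg (d⁄dX K) h
  rw [Derivation.leibniz, Derivation.map_one_eq_zero, smul_eq_mul, smul_eq_mul] at h1
  linear_combination (-d⁄dX K v) * h + v * h1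

theorem PowerSeries.coeff_eq_of_X_pow_dvd_sub {f g : K⟦X⟧} {m n : ℕ} (h : X ^ m ∣ f - g)
    (hn : n < m) : coeff n f = coeff n g :=
  sub_eq_zero.1 (by rw [← map_sub]; exact X_pow_dvd_iff.1 h n hn)

variable [CharZero K]

/-- A Lagrange-type residue computation: `u ^ r` has no residue against `d u` when `u = X v`. -/
theorem PowerSeries.coeff_derivative_pow_mul_pow {v w : K⟦X⟧} (h : v * w = 1) {r s : ℕ}
    (hr : r < s) : coeff (s - 1) (d⁄dX K ((X * v) ^ r) * w ^ s) = 0 := by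
  rcases Nat.eq_zero_or_pos r with rfl | hr0
  · simp
  obtain ⟨r, rfl⟩ := Nat.exists_eq_add_of_le' hr0
  obtain ⟨m, rfl⟩ : ∃ m, s = r + 1 + (m + 1) := ⟨s - r - 2, by omega⟩
  have hv := derivative_of_mul_eq_one h
  have h1 : d⁄dX K ((X * v) ^ (r + 1)) * w ^ (r + 1 + (m + 1)) =
      X ^ r * (C ((r : K) + 1) * (w ^ (m + 1) - X * (w ^ m * d⁄dX K w))) := by
    have h2 : v ^ r * w ^ r = 1 := by rw [← mul_pow, h, one_pow]
    rw [Derivation.leibniz_pow, Derivation.leibniz, derivative_X, hv]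
    simp only [smul_eq_mul, nsmul_eq_mul, Nat.cast_add, Nat.cast_one, add_tsub_cancel_right,
      map_add, map_natCast, map_one]
    calc _ = ((r : K⟦X⟧) + 1) * X ^ r * (v ^ r * w ^ r) * w ^ m *
          ((v * w) * w - X * (v * w) ^ 2 * d⁄dX K w) := by ring
      _ = _ := by
        rw [h2, h]
        ring
  have h3 : coeff (m + 1) (w ^ (m + 1)) = coeff m (w ^ m * d⁄dX K w) := by
    have h4 := coeff_derivative (R := K) (w ^ (m + 1)) m
    rw [Derivation.leibniz_pow, add_tsub_cancel_right, smul_eq_mul, map_nsmul,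
      nsmul_eq_mul, Nat.cast_add, Nat.cast_one, mul_comm] at h4
    exact (mul_right_cancel₀ (Nat.cast_add_one_ne_zero m) h4).symm
  rw [h1, show r + 1 + (m + 1) - 1 = m + 1 + r by omega, coeff_X_pow_mul, coeff_C_mul, map_sub,
    coeff_succ_X_mul, h3, sub_self, mul_zero]

theorem PowerSeries.coeff_derivative_mul_pow_eq_zero_of_mem_span {E W Q P T : K⟦X⟧} {j s : ℕ}
    (hQ : E * Q = 1) (hP : W * P = 1) (hj : j < 3 * s)
    (hT : T ∈ Submodule.span K {f | ∃ r, 3 * r ≤ j ∧ f = E ^ (j - 3 * r) * (X * W) ^ r}) :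
    coeff (s - 1) (d⁄dX K (T * Q ^ j) * (E ^ 3 * P) ^ s) = 0 := by
  have hvw : Q ^ 3 * W * (E ^ 3 * P) = 1 := by
    calc _ = (E * Q) ^ 3 * (W * P) := by ring
      _ = 1 := by rw [hQ, hP, one_pow, one_mul]
  induction hT using Submodule.span_induction with
  | mem f hf =>
    obtain ⟨r, hr, rfl⟩ := hf
    have h1 : E ^ (j - 3 * r) * (X * W) ^ r * Q ^ j = (X * (Q ^ 3 * W)) ^ r := by
      obtain ⟨i, rfl⟩ := Nat.exists_eq_add_of_le' hr
      rw [add_tsub_cancel_right]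
      calc _ = (E * Q) ^ i * (X * (Q ^ 3 * W)) ^ r := by ring
        _ = _ := by rw [hQ, one_pow, one_mul]
    rw [h1]
    exact coeff_derivative_pow_mul_pow hvw (by omega)
  | zero => simp
  | add f g _ _ hf hg => rw [add_mul, map_add, add_mul, map_add, hf, hg, add_zero]
  | smul c f _ hf => rw [smul_mul_assoc, Derivation.map_smul, smul_mul_assoc, map_smul, hf, smul_zero]

/-- The coefficient identity obtained from a form of weight `4 * j` whose expansion agrees with
`G ^ (8 * j)` to high order. -/
theorem PowerSeries.coeff_bracket_mul_eq_zero {E W P T G : K⟦X⟧} {j s : ℕ}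
    (hE : constantCoeff E = 1) (hW : constantCoeff W = 1)
    (hP : X ^ s ∣ P * W - 1) (hj0 : 0 < j) (hj : j < 3 * s)
    (hT : T ∈ Submodule.span K {f | ∃ r, 3 * r ≤ j ∧ f = E ^ (j - 3 * r) * (X * W) ^ r})
    (hG : X ^ (s + 1) ∣ T - G ^ (8 * j)) :
    coeff (s - 1) ((G * d⁄dX K E - 8 * (d⁄dX K G * E)) *
      (P ^ s * (G ^ (8 * j - 1) * E ^ (3 * s - j - 1)))) = 0 := by
  have hQ : E * E⁻¹ = 1 := PowerSeries.mul_inv_cancel E (by rw [hE]; exact one_ne_zero)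
  have hW' : W * W⁻¹ = 1 := PowerSeries.mul_inv_cancel W (by rw [hW]; exact one_ne_zero)
  set Q := E⁻¹
  have h0 := coeff_derivative_mul_pow_eq_zero_of_mem_span hQ hW' hj hT
  have hs : s - 1 < s := by omega
  have h1 : coeff (s - 1) (d⁄dX K (G ^ (8 * j) * Q ^ j) * (E ^ 3 * P) ^ s) = 0 := by
    rw [← h0]
    refine (coeff_eq_of_X_pow_dvd_sub (m := s) ?_ hs).symm
    have h2 : X ^ s ∣ d⁄dX K (T * Q ^ j) - d⁄dX K (G ^ (8 * j) * Q ^ j) := by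
      obtain ⟨Z, hZ⟩ := hG
      rw [← map_sub, ← sub_mul, hZ, mul_assoc, Derivation.leibniz, Derivation.leibniz_pow,
        add_tsub_cancel_right, smul_eq_mul, smul_eq_mul]
      refine dvd_add ((pow_dvd_pow X s.le_succ).mul_right _) (Dvd.dvd.mul_left ?_ _)
      rw [nsmul_eq_mul, smul_eq_mul]
      exact (dvd_mul_right _ _).mul_left _
    have h3 : X ^ s ∣ (E ^ 3 * W⁻¹) ^ s - (E ^ 3 * P) ^ s := by
      refine Dvd.dvd.trans ?_ (sub_dvd_pow_sub_pow _ _ s)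
      rw [← mul_sub]
      refine Dvd.dvd.mul_left ?_ _
      have : W⁻¹ - P = (P * W - 1) * -W⁻¹ := by linear_combination P * hW'
      rw [this]
      exact hP.mul_right _
    have : d⁄dX K (T * Q ^ j) * (E ^ 3 * W⁻¹) ^ s - d⁄dX K (G ^ (8 * j) * Q ^ j) * (E ^ 3 * P) ^ s =
        (d⁄dX K (T * Q ^ j) - d⁄dX K (G ^ (8 * j) * Q ^ j)) * (E ^ 3 * W⁻¹) ^ s +
        d⁄dX K (G ^ (8 * j) * Q ^ j) * ((E ^ 3 * W⁻¹) ^ s - (E ^ 3 * P) ^ s) := by ring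
    rw [this]
    exact dvd_add (h2.mul_right _) (h3.mul_left _)
  obtain ⟨i, rfl⟩ := Nat.exists_eq_add_of_le' hj0
  obtain ⟨e, he⟩ : ∃ e, 3 * s = e + (i + 1) + 1 := ⟨3 * s - i - 2, by omega⟩
  have h4 : d⁄dX K (G ^ (8 * (i + 1)) * Q ^ (i + 1)) * (E ^ 3 * P) ^ s =
      C (-((i : K) + 1)) * ((G * d⁄dX K E - 8 * (d⁄dX K G * E)) *
      (P ^ s * (G ^ (8 * (i + 1) - 1) * E ^ (3 * s - (i + 1) - 1)))) := by
    have hQ' := derivative_of_mul_eq_one ((mul_comm Q E).trans hQ)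
    rw [Derivation.leibniz, Derivation.leibniz_pow, Derivation.leibniz_pow, hQ', mul_pow,
      ← pow_mul, he, show e + (i + 1) + 1 - (i + 1) - 1 = e by omega,
      show 8 * (i + 1) - 1 = 8 * i + 7 by omega, show 8 * (i + 1) = 8 * i + 7 + 1 by omega]
    simp only [smul_eq_mul, nsmul_eq_mul, Nat.cast_add, Nat.cast_one, add_tsub_cancel_right,
      map_add, map_natCast, map_one, Nat.cast_mul, Nat.cast_ofNat, map_neg]
    have hEQ : (E * Q) ^ (i + 2) = 1 := by rw [hQ, one_pow]
    have hEQ' : E ^ (e + (i + 1) + 1) * Q ^ (i + 2) = E ^ e := by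
      rw [← mul_one (E ^ e), ← hEQ]
      ring
    have hEQ'' : E ^ (e + (i + 1) + 1) * Q ^ (i + 1) = E ^ e * E := by
      calc _ = E ^ e * E * (E * Q) ^ (i + 1) := by ring
        _ = _ := by rw [hQ, one_pow, mul_one]
    linear_combination (-(i + 1) * G ^ (8 * i + 8) * d⁄dX K E * P ^ s) * hEQ' +
      (8 * (i + 1) * G ^ (8 * i + 7) * d⁄dX K G * P ^ s) * hEQ''
  rw [h4, coeff_C_mul] at h1
  exact (mul_eq_zero.1 h1).resolve_left (neg_ne_zero.2 (Nat.cast_add_one_ne_zero i))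

end Residue

section Expansions

open UpperHalfPlane ModularForm MatrixGroups EisensteinSeries Filter PowerSeries

theorem qExpansion_mem_span (j : ℕ) (F : ModularForm 𝒮ℒ (4 * j : ℤ)) :
    qExpansion 1 F ∈ Submodule.span ℂ {f : ℂ⟦X⟧ | ∃ r, 3 * r ≤ j ∧
      f = (qExpansion 1 E₄) ^ (j - 3 * r) * (qExpansion 1 ModularForm.discriminant) ^ r} := by
  induction j using Nat.strong_induction_on with
  | _ j ih =>
  have hw : ((j : ℕ) : ℤ) * (4 : ℕ) = 4 * j := by push_cast; ring
  let M : ModularForm 𝒮ℒ (4 * j : ℤ) := ModularForm.mcast hw (E₄.pow j)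
  have hM : qExpansion 1 M = (qExpansion 1 E₄) ^ j :=
    ModularForm.qExpansion_pow one_pos one_mem_strictPeriods_SL E₄ j
  set a := (qExpansion 1 F).coeff 0 with ha
  obtain ⟨H, hH⟩ : ∃ H : ModularForm 𝒮ℒ (4 * j : ℤ), H = F - a • M := ⟨_, rfl⟩
  have hsub : qExpansion 1 H = qExpansion 1 F - a • (qExpansion 1 E₄) ^ j := by
    rw [hH, FunLike.coe_sub, ModularForm.qExpansion_sub one_pos one_mem_strictPeriods_SL F (a • M),
      FunLike.coe_smul, ModularForm.qExpansion_smul one_pos one_mem_strictPeriods_SL a M, hM]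
  have hE0 : (qExpansion 1 E₄).coeff 0 = 1 := E_qExpansion_coeff_zero _ ⟨2, rfl⟩
  have h0 : (qExpansion 1 H).coeff 0 = 0 := by
    rw [coeff_zero_eq_constantCoeff_apply] at hE0 ha
    rw [hsub, map_sub, PowerSeries.coeff_smul, coeff_zero_eq_constantCoeff_apply,
      coeff_zero_eq_constantCoeff_apply, map_pow, hE0, ha]
    simp
  have hmul := ModularForm.qExpansion_eq_qExpansion_discriminant_mul H h0
  obtain ⟨D, hD⟩ : ∃ D, D = CuspForm.discriminantEquiv (toCuspForm H h0) := ⟨_, rfl⟩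
  rw [← hD, hsub, sub_eq_iff_eq_add'] at hmul
  rw [hmul]
  refine add_mem (Submodule.smul_mem _ _ (Submodule.subset_span ⟨0, by simp⟩)) ?_
  rcases lt_or_ge j 3 with hj | hj
  · have hD : (D : ℍ → ℂ) = 0 := ModularFormClass.levelOne_neg_weight_eq_zero (by omega) D
    rw [hD, qExpansion_zero, mul_zero]
    exact zero_mem _
  · have hD := ih (j - 3) (by omega) (ModularForm.mcast (by omega) D)
    rw [ModularForm.qExpansion_mcast (by omega) rfl] at hD
    refine Submodule.span_induction (p := fun f _ => qExpansion 1 ModularForm.discriminant * f ∈ _)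
      ?_ (by simp) ?_ ?_ hD
    · rintro f ⟨r, hr, rfl⟩
      refine Submodule.subset_span ⟨r + 1, by omega, ?_⟩
      rw [show j - 3 - 3 * r = j - 3 * (r + 1) by omega]
      ring
    · intro f g _ _ hf hg
      rw [mul_add]
      exact add_mem hf hg
    · intro c f _ hf
      rw [mul_smul_comm]
      exact Submodule.smul_mem _ _ hf

theorem tendstoLocallyUniformlyOn_eval_iterate_derivative {p : ℕ → Polynomial ℂ} {f : ℂ → ℂ}
    {U : Set ℂ} (hU : IsOpen U)
    (h : TendstoLocallyUniformlyOn (fun N q => (p N).eval q) f atTop U) (m : ℕ) :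
    TendstoLocallyUniformlyOn (fun N q => (Polynomial.derivative^[m] (p N)).eval q)
      (iteratedDeriv m f) atTop U := by
  induction m with
  | zero => simpa using h
  | succ m ih =>
    have h1 := ih.deriv (.of_forall fun N => Polynomial.differentiableOn _) hU
    rw [← iteratedDeriv_succ] at h1
    refine h1.congr fun N q _ => ?_
    simp [Function.iterate_succ_apply']

theorem tendsto_coeff_of_tendstoLocallyUniformlyOn {p : ℕ → Polynomial ℂ} {f : ℂ → ℂ}
    {U : Set ℂ} (hU : IsOpen U) (h0 : (0 : ℂ) ∈ U)
    (h : TendstoLocallyUniformlyOn (fun N q => (p N).eval q) f atTop U) (m : ℕ) :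
    Tendsto (fun N => (p N).coeff m) atTop
      (nhds ((m.factorial : ℂ)⁻¹ * iteratedDeriv m f 0)) := by
  have h1 := (tendstoLocallyUniformlyOn_eval_iterate_derivative hU h m).tendsto_at h0
  refine (h1.const_mul ((m.factorial : ℂ)⁻¹)).congr fun N => ?_
  rw [← Polynomial.coeff_zero_eq_eval_zero, Polynomial.coeff_iterate_derivative, zero_add,
    Nat.descFactorial_self, nsmul_eq_mul,
    inv_mul_cancel_left₀ (Nat.cast_ne_zero.2 m.factorial_ne_zero)]

theorem tendstoLocallyUniformlyOn_discriminant_product :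
    TendstoLocallyUniformlyOn
      (fun N q => ((Polynomial.X : Polynomial ℂ) *
        ∏ i ∈ Finset.range N, (1 - Polynomial.X ^ (i + 1)) ^ 24).eval q)
      (cuspFunction 1 ModularForm.discriminant) atTop (Metric.ball 0 1) := by
  have h1 := (multipliableLocallyUniformlyOn_one_sub_pow.hasProdLocallyUniformlyOn
    |>.tendstoLocallyUniformlyOn_finsetRange)
  have hc : ContinuousOn (fun q : ℂ => ∏' n : ℕ, (1 - q ^ (n + 1))) (Metric.ball 0 1) :=
    differentiableOn_tprod_one_sub_pow.continuousOn
  have h2 : ∀ d : ℕ, TendstoLocallyUniformlyOn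
      (fun (N : ℕ) (q : ℂ) => (∏ i ∈ Finset.range N, (1 - q ^ (i + 1))) ^ d)
      (fun q => (∏' n : ℕ, (1 - q ^ (n + 1))) ^ d) atTop (Metric.ball 0 1) := by
    intro d
    induction d with
    | zero =>
      simp only [pow_zero]
      exact fun u hu x _ => ⟨Set.univ, Filter.univ_mem, .of_forall fun _ _ _ => refl_mem_uniformity hu⟩
    | succ d ih =>
      simp only [pow_succ]
      exact ih.fun_mul₀ h1 (hc.pow d) hc
  have h3 : TendstoLocallyUniformlyOn (fun (_ : ℕ) (q : ℂ) => q) (fun q => q) atTop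
      (Metric.ball 0 1) :=
    fun u hu x _ => ⟨Set.univ, Filter.univ_mem, .of_forall fun _ _ _ => refl_mem_uniformity hu⟩
  have h4 := h3.fun_mul₀ (h2 24) continuousOn_id (hc.pow 24)
  refine (h4.congr fun N q _ => ?_).congr_right fun q hq => ?_
  · simp [Polynomial.eval_prod, Finset.prod_pow]
  · rw [discriminant_cuspFunction_eqOn hq]
    simp only
    rw [(multipliable_one_sub_pow (by simpa using hq)).tprod_pow]

theorem X_pow_dvd_prod_one_sub_X_pow_sub {R : Type*} [CommRing R] {s N : ℕ} (hN : s ≤ N) :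
    (X : R⟦X⟧) ^ (s + 1) ∣ ∏ i ∈ Finset.range N, (1 - X ^ (i + 1)) ^ 24 -
      ∏ i ∈ Finset.range s, (1 - X ^ (i + 1)) ^ 24 := by
  induction N, hN using Nat.le_induction with
  | base => simp
  | succ N hN ih =>
    rw [Finset.prod_range_succ]
    have h1 : (X : R⟦X⟧) ^ (s + 1) ∣ (1 - X ^ (N + 1)) ^ 24 - 1 := by
      have := sub_dvd_pow_sub_pow (1 - (X : R⟦X⟧) ^ (N + 1)) 1 24
      rw [one_pow, sub_sub_cancel_left, neg_dvd] at this
      exact (pow_dvd_pow _ (by omega)).trans this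
    have h2 := dvd_add (h1.mul_left (∏ i ∈ Finset.range N, (1 - (X : R⟦X⟧) ^ (i + 1)) ^ 24)) ih
    convert h2 using 1
    ring

theorem exists_qExpansion_discriminant_eq (s : ℕ) :
    ∃ W : ℂ⟦X⟧, qExpansion 1 ModularForm.discriminant = X * W ∧ constantCoeff W = 1 ∧
      X ^ (s + 1) ∣ W - ∏ i ∈ Finset.range s, (1 - X ^ (i + 1)) ^ 24 := by
  have h0 : constantCoeff (qExpansion 1 ModularForm.discriminant) = 0 := by
    have := CuspFormClass.qExpansion_coeff_zero CuspForm.discriminant one_pos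
      one_mem_strictPeriods_SL
    rwa [coeff_zero_eq_constantCoeff_apply] at this
  obtain ⟨W, hW⟩ := X_dvd_iff.2 h0
  refine ⟨W, hW, ?_, ?_⟩
  · have := discriminant_qExpansion_coeff_one
    rwa [hW, ← zero_add 1, coeff_succ_X_mul, coeff_zero_eq_constantCoeff_apply] at this
  rw [X_pow_dvd_iff]
  intro m hm
  have h1 := tendsto_coeff_of_tendstoLocallyUniformlyOn Metric.isOpen_ball
    (Metric.mem_ball_self one_pos) tendstoLocallyUniformlyOn_discriminant_product (m + 1)
  rw [← qExpansion_coeff, hW, coeff_succ_X_mul] at h1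
  have h2 : ∀ᶠ N in atTop, ((Polynomial.X : Polynomial ℂ) *
      ∏ i ∈ Finset.range N, (1 - Polynomial.X ^ (i + 1)) ^ 24).coeff (m + 1) =
      coeff m (∏ i ∈ Finset.range s, (1 - (X : ℂ⟦X⟧) ^ (i + 1)) ^ 24) := by
    filter_upwards [eventually_ge_atTop s] with N hN
    have h3 := X_pow_dvd_iff.1 (X_pow_dvd_prod_one_sub_X_pow_sub (R := ℂ) hN) m hm
    rw [map_sub, sub_eq_zero] at h3
    rw [Polynomial.coeff_X_mul, ← h3, ← Polynomial.coeff_coe]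
    congr 1
    rw [← Polynomial.coeToPowerSeries.ringHom_apply, map_prod]
    refine Finset.prod_congr rfl fun i _ => ?_
    rw [map_pow, map_sub, map_one, map_pow, Polynomial.coeToPowerSeries.ringHom_apply,
      Polynomial.coe_X]
  rw [map_sub, sub_eq_zero]
  exact tendsto_nhds_unique h1 (tendsto_const_nhds.congr' (h2.mono fun N h => h.symm))

end Expansions

section Contradiction

open UpperHalfPlane ModularForm MatrixGroups EisensteinSeries PowerSeries

theorem qExpansion_E₄_eq_map :
    qExpansion 1 E₄ = PowerSeries.map Complex.ofRealHom eisensteinFourSeries := by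
  ext n
  rw [E_qExpansion_coeff _ ⟨2, rfl⟩, coeff_map, eisensteinFourSeries, coeff_mk]
  split_ifs with h
  · simp
  · norm_num [show bernoulli 4 = -1 / 30 by decide +kernel]

theorem derivative_map_ofReal (f : ℝ⟦X⟧) :
    d⁄dX ℂ (PowerSeries.map Complex.ofRealHom f) = PowerSeries.map Complex.ofRealHom (d⁄dX ℝ f) := by
  ext n
  simp [coeff_derivative]

theorem mk_dvd_mul_one_sub_X_pow {R : Type*} [CommRing R] (i : ℕ) :
    (PowerSeries.mk fun n => if (i + 1) ∣ n then (1 : R) else 0) * (1 - X ^ (i + 1)) = 1 := by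
  ext n
  rw [mul_sub, mul_one, map_sub, coeff_mk, coeff_mul_X_pow', coeff_mk, coeff_one]
  rcases Nat.eq_zero_or_pos n with rfl | hn
  · simp
  rw [if_neg (by omega : n ≠ 0)]
  by_cases h : i + 1 ≤ n
  · rw [if_pos h]
    simp [Nat.dvd_sub_iff_left h (dvd_refl _)]
  · rw [if_neg h, if_neg (fun hd => h (Nat.le_of_dvd hn hd)), sub_zero]

/-- A level one form of weight `4 * j` cannot agree to order `s > j / 3` with the `8 * j`-th power
of a series with constant term one and coefficients in `[0, 2]`. -/
theorem not_X_pow_dvd_qExpansion_sub_pow {j s : ℕ} (hj0 : 0 < j) (hj : j < 3 * s)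
    (F : ModularForm 𝒮ℒ (4 * j : ℤ)) {G : ℝ⟦X⟧} (hg0 : coeff 0 G = 1)
    (hg : ∀ n, 0 ≤ coeff n G) (hg2 : ∀ n, coeff n G ≤ 2) :
    ¬ X ^ (s + 1) ∣ qExpansion 1 F - PowerSeries.map Complex.ofRealHom G ^ (8 * j) := by
  intro hG
  obtain ⟨W, hW, hW1, hWA⟩ := exists_qExpansion_discriminant_eq s
  have hT := qExpansion_mem_span j F
  rw [hW, qExpansion_E₄_eq_map] at hT
  let g : ℕ → ℝ⟦X⟧ := fun i => PowerSeries.mk fun n => if (i + 1) ∣ n then (1 : ℝ) else 0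
  have hg' : ∀ i n, 0 ≤ coeff n (g i) := by
    intro i n
    simp only [g, coeff_mk]
    split_ifs <;> norm_num
  let P : ℝ⟦X⟧ := ∏ i ∈ Finset.range s, g i ^ 24
  have hPA : P * ∏ i ∈ Finset.range s, (1 - X ^ (i + 1)) ^ 24 = 1 := by
    rw [← Finset.prod_mul_distrib]
    refine Finset.prod_eq_one fun i _ => ?_
    rw [← mul_pow, mk_dvd_mul_one_sub_X_pow, one_pow]
  have hPW : X ^ s ∣ PowerSeries.map Complex.ofRealHom P * W - 1 := by
    obtain ⟨Z, hZ⟩ := hWA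
    have h1 := congrArg (PowerSeries.map Complex.ofRealHom) hPA
    simp only [map_mul, map_prod, map_pow, map_sub, map_one, map_X] at h1
    refine ⟨X * (PowerSeries.map Complex.ofRealHom P * Z), ?_⟩
    linear_combination PowerSeries.map Complex.ofRealHom P * hZ + h1
  have hE1 : constantCoeff (PowerSeries.map Complex.ofRealHom eisensteinFourSeries) = 1 := by
    rw [← coeff_zero_eq_constantCoeff_apply, coeff_map, eisensteinFourSeries, coeff_mk]
    simp
  have hzero := coeff_bracket_mul_eq_zero hE1 hW1 hPW hj0 hj hT hG
  rw [derivative_map_ofReal, derivative_map_ofReal,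
    show (8 : ℂ⟦X⟧) = PowerSeries.map Complex.ofRealHom 8 from (map_ofNat _ 8).symm] at hzero
  simp only [← map_mul, ← map_pow, ← map_sub, coeff_map, Complex.ofRealHom_eq_coe,
    Complex.ofReal_eq_zero] at hzero
  have hP : P = PowerSeries.mk 1 ^ 24 * ∏ i ∈ Finset.range (s - 1), g (i + 1) ^ 24 := by
    obtain ⟨t, rfl⟩ : ∃ t, s = t + 1 := ⟨s - 1, by omega⟩
    have h0 : g 0 = PowerSeries.mk 1 := by
      ext n
      simp [g]
    simp only [P]
    rw [Finset.prod_range_succ', h0, mul_comm, add_tsub_cancel_right]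
  set R := ∏ i ∈ Finset.range (s - 1), g (i + 1) ^ 24
  have hR : ∀ n, 0 ≤ coeff n R :=
    coeff_prod_nonneg _ fun i _ => coeff_pow_nonneg (hg' _) _
  rw [hP, mul_pow, ← pow_mul, mul_assoc (PowerSeries.mk 1 ^ (24 * s))] at hzero
  have hV : ∀ n, 0 ≤ coeff n
      (R ^ s * (G ^ (8 * j - 1) * eisensteinFourSeries ^ (3 * s - j - 1))) :=
    coeff_mul_nonneg (coeff_pow_nonneg hR _) (coeff_mul_nonneg (coeff_pow_nonneg hg _)
      (coeff_pow_nonneg eisensteinFourSeries_coeff_nonneg _))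
  have hmk : coeff 0 ((PowerSeries.mk 1 : ℝ⟦X⟧) ^ (24 * s)) = 1 := by
    rw [coeff_zero_eq_constantCoeff_apply, map_pow, ← coeff_zero_eq_constantCoeff_apply, coeff_mk]
    simp
  refine (coeff_bracket_mul_pos hg0 hg hg2 ?_ fun n hn => ?_).ne' hzero
  · have hg1 : constantCoeff G = 1 := by rwa [← coeff_zero_eq_constantCoeff_apply]
    have hE1' : constantCoeff eisensteinFourSeries = 1 := by
      rw [← coeff_zero_eq_constantCoeff_apply, eisensteinFourSeries, coeff_mk, if_pos rfl]
    have hgc : ∀ i, constantCoeff (g i) = 1 := by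
      intro i
      rw [← coeff_zero_eq_constantCoeff_apply]
      simp [g]
    rw [coeff_zero_eq_constantCoeff_apply] at hmk ⊢
    rw [map_mul, hmk]
    simp only [R, map_mul, map_pow, map_prod, hg1, hE1', hgc]
    norm_num
  · exact coeff_mul_growth (hmk ▸ zero_le_one)
      (fun m hm => coeff_geometric_pow_growth s m hm) hV n (by omega)

end Contradiction

section ResidueTheta

open Complex Real

/-- The theta series `∑_{m ≡ a (mod N)} exp(π i m² τ / N)` of a residue class modulo `N`. -/
noncomputable def residueTheta (N : ℕ) (a : ZMod N) (τ : ℂ) : ℂ :=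
  cexp (π * I * (a.val : ℂ) ^ 2 * τ / N) * jacobiTheta₂ (a.val * τ) (N * τ)

theorem hasSum_residueTheta {N : ℕ} [NeZero N] (a : ZMod N) {τ : ℂ} (hτ : 0 < τ.im) :
    HasSum (fun l : ℤ => cexp (π * I * ((a.val : ℂ) + N * l) ^ 2 * τ / N))
      (residueTheta N a τ) := by
  have hN : (0 : ℝ) < N := by exact_mod_cast Nat.pos_of_ne_zero (NeZero.ne N)
  have hN' : (N : ℂ) ≠ 0 := by exact_mod_cast NeZero.ne N
  have h := (hasSum_jacobiTheta₂_term (a.val * τ) (τ := N * τ)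
    (by simpa using mul_pos hN hτ)).mul_left (cexp (π * I * (a.val : ℂ) ^ 2 * τ / N))
  refine h.congr_fun fun l => ?_
  rw [jacobiTheta₂_term, ← Complex.exp_add]
  congr 1
  field_simp
  ring

theorem residueTheta_add_one {N : ℕ} [NeZero N] (hN2 : Even N) (a : ZMod N) {τ : ℂ}
    (hτ : 0 < τ.im) :
    residueTheta N a (τ + 1) = cexp (π * I * (a.val : ℂ) ^ 2 / N) * residueTheta N a τ := by
  have hN' : (N : ℂ) ≠ 0 := by exact_mod_cast NeZero.ne N
  refine (hasSum_residueTheta a (τ := τ + 1) (by simpa using hτ)).unique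
    (((hasSum_residueTheta a hτ).mul_left (cexp (π * I * (a.val : ℂ) ^ 2 / N))).congr_fun
      fun l => ?_)
  obtain ⟨r, rfl⟩ := hN2
  rw [← Complex.exp_add, Complex.exp_eq_exp_iff_exists_int]
  refine ⟨(r * l ^ 2 + a.val * l), ?_⟩
  field_simp
  push_cast
  ring

/-- Division with remainder as a bijection. -/
def zmodProdIntEquiv (N : ℕ) [NeZero N] : ZMod N × ℤ ≃ ℤ where
  toFun p := p.1.val + N * p.2
  invFun m := (m, m / N)
  left_inv p := by
    have hN : (N : ℤ) ≠ 0 := by exact_mod_cast NeZero.ne N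
    have hlt : (p.1.val : ℤ) < N := by exact_mod_cast ZMod.val_lt p.1
    ext
    · simp
    · exact (Int.add_mul_ediv_left _ _ hN).trans
        (by rw [Int.ediv_eq_zero_of_lt (Int.natCast_nonneg _) hlt, zero_add])
  right_inv m := by
    simp only [ZMod.val_intCast]
    exact Int.emod_add_mul_ediv m N

theorem jacobiTheta₂_eq_sum_residueTheta {N : ℕ} [NeZero N] (a : ZMod N) {τ : ℂ}
    (hτ : 0 < τ.im) :
    jacobiTheta₂ ((a.val : ℂ) / N) (τ / N) =
      ∑ b : ZMod N, ZMod.stdAddChar (a * b) * residueTheta N b τ := by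
  have hN : (0 : ℝ) < N := by exact_mod_cast Nat.pos_of_ne_zero (NeZero.ne N)
  have hN' : (N : ℂ) ≠ 0 := by exact_mod_cast NeZero.ne N
  have h := hasSum_jacobiTheta₂_term ((a.val : ℂ) / N) (τ := τ / N)
    (by simpa using div_pos hτ hN)
  rw [← (zmodProdIntEquiv N).hasSum_iff] at h
  refine (h.prod_fiberwise fun b => ?_).unique (hasSum_fintype _)
  refine ((hasSum_residueTheta b hτ).mul_left (ZMod.stdAddChar (a * b))).congr_fun
    fun l => ?_
  have hab : a * b = ((a.val * (b.val + N * l) : ℤ) : ZMod N) := by simp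
  rw [hab, ZMod.stdAddChar_coe, ← Complex.exp_add]
  simp only [Function.comp, jacobiTheta₂_term, zmodProdIntEquiv, Equiv.coe_fn_mk]
  congr 1
  push_cast
  field_simp

theorem residueTheta_neg_inv {N : ℕ} [NeZero N] (a : ZMod N) {τ : ℂ} (hτ : 0 < τ.im) :
    residueTheta N a (-1 / τ) = (-I * (τ / N)) ^ (1 / 2 : ℂ) *
      ∑ b : ZMod N, ZMod.stdAddChar (a * b) * residueTheta N b τ := by
  have hN' : (N : ℂ) ≠ 0 := by exact_mod_cast NeZero.ne N
  have hτ0 : τ ≠ 0 := by rintro rfl; simp at hτ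
  have hk : (-I * (τ / N)) ^ (1 / 2 : ℂ) ≠ 0 := by
    rw [Ne, Complex.cpow_eq_zero_iff]
    simp [hτ0, hN']
  rw [← jacobiTheta₂_eq_sum_residueTheta a hτ, jacobiTheta₂_functional_equation,
    residueTheta, ← jacobiTheta₂_neg_left]
  rw [← mul_assoc, ← mul_assoc, mul_one_div_cancel hk, one_mul]
  congr 1
  · congr 1
    field_simp
  · congr 1 <;> field_simp

theorem differentiableAt_residueTheta {N : ℕ} [NeZero N] (a : ZMod N) {τ : ℂ} (hτ : 0 < τ.im) :
    DifferentiableAt ℂ (residueTheta N a) τ := by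
  have hN : (0 : ℝ) < N := by exact_mod_cast Nat.pos_of_ne_zero (NeZero.ne N)
  have h1 : DifferentiableAt ℂ (fun p : ℂ × ℂ => jacobiTheta₂ p.1 p.2) (a.val * τ, N * τ) :=
    (hasFDerivAt_jacobiTheta₂ _ (by simpa using mul_pos hN hτ)).differentiableAt
  have h2 : DifferentiableAt ℂ (fun τ : ℂ => ((a.val * τ, N * τ) : ℂ × ℂ)) τ := by fun_prop
  have h3 := h1.comp τ h2
  unfold residueTheta
  exact DifferentiableAt.mul (by fun_prop) h3

theorem residueTheta_I_pos {N : ℕ} [NeZero N] (a : ZMod N) :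
    ∃ r : ℝ, 0 < r ∧ residueTheta N a I = r := by
  have h := hasSum_residueTheta a (τ := I) (by simp)
  have he : ∀ l : ℤ, cexp (π * I * ((a.val : ℂ) + N * l) ^ 2 * I / N) =
      ((Real.exp (-π * (a.val + N * l) ^ 2 / N) : ℝ) : ℂ) := by
    intro l
    push_cast
    congr 1
    linear_combination (π * ((a.val : ℂ) + N * l) ^ 2 / N) * I_sq
  simp_rw [he] at h
  have hs := Complex.summable_ofReal.mp h.summable
  refine ⟨_, hs.tsum_pos (fun _ => (Real.exp_pos _).le) 0 (Real.exp_pos _), ?_⟩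
  rw [← h.tsum_eq, Complex.ofReal_tsum]

end ResidueTheta

section CodeTheta

open Complex Real

variable {N n : ℕ} [NeZero N]

/-- The sum over a set of words of the products of the theta series of their letters. -/
noncomputable def wordTheta (T : Finset (Fin n → ZMod N)) (τ : ℂ) : ℂ :=
  ∑ c ∈ T, ∏ i, residueTheta N (c i) τ

/-- The finite set of codewords. -/
noncomputable def codewords (C : Submodule (ZMod N) (Fin n → ZMod N)) :
    Finset (Fin n → ZMod N) :=
  open Classical in Finset.univ.filter (· ∈ C)

theorem mem_codewords {C : Submodule (ZMod N) (Fin n → ZMod N)} {c : Fin n → ZMod N} :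
    c ∈ codewords C ↔ c ∈ C := by
  simp [codewords]

theorem AddChar.map_sum_eq_prod_map {A M ι : Type*} [AddCommMonoid A] [CommMonoid M]
    (ψ : AddChar A M) (s : Finset ι) (f : ι → A) : ψ (∑ i ∈ s, f i) = ∏ i ∈ s, ψ (f i) := by
  classical
  induction s using Finset.induction_on with
  | empty => simp
  | insert a s ha ih => rw [Finset.sum_insert ha, Finset.prod_insert ha, map_add_eq_mul, ih]

theorem sum_stdAddChar_codewords {C : Submodule (ZMod N) (Fin n → ZMod N)}
    (hC : IsSelfDualCode C) (x : Fin n → ZMod N) :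
    ∑ c ∈ codewords C, ZMod.stdAddChar (∑ i, c i * x i) =
      if x ∈ codewords C then ((codewords C).card : ℂ) else 0 := by
  classical
  let f : C →+ ZMod N := AddMonoidHom.mk' (fun c => ∑ i, c.1 i * x i) fun a b => by
    simp [add_mul, Finset.sum_add_distrib]
  let ψ : AddChar C ℂ := (ZMod.stdAddChar (N := N)).compAddMonoidHom f
  have hψ : ψ = 0 ↔ x ∈ codewords C := by
    rw [mem_codewords, ← SetLike.mem_coe, hC]
    constructor
    · intro h y hy
      have h1 : ψ ⟨y, hy⟩ = 1 := by rw [h]; rfl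
      have h2 : f ⟨y, hy⟩ = 0 := by
        apply ZMod.injective_stdAddChar (N := N)
        rw [AddChar.map_zero_eq_one]
        exact h1
      simpa [f, mul_comm] using h2
    · intro h
      ext c
      have h2 : f c = 0 := by simpa [f, mul_comm] using h c.1 c.2
      simp [ψ, h2]
  have hsum := AddChar.sum_eq_ite ψ
  rw [Finset.sum_subtype (codewords C) (p := (· ∈ C)) fun _ => mem_codewords]
  have hcard : Fintype.card C = (codewords C).card :=
    Fintype.card_of_subtype (codewords C) fun _ => mem_codewords
  rw [← hcard, ← if_congr hψ rfl rfl, ← hsum]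
  rfl

theorem wordTheta_codewords_neg_inv {C : Submodule (ZMod N) (Fin n → ZMod N)}
    (hC : IsSelfDualCode C) {τ : ℂ} (hτ : 0 < τ.im) :
    wordTheta (codewords C) (-1 / τ) = ((-I * (τ / N)) ^ (1 / 2 : ℂ)) ^ n *
      (codewords C).card * wordTheta (codewords C) τ := by
  set κ := (-I * (τ / N)) ^ (1 / 2 : ℂ)
  have h1 : ∀ c : Fin n → ZMod N, ∏ i, residueTheta N (c i) (-1 / τ) = κ ^ n *
      ∑ x : Fin n → ZMod N, ZMod.stdAddChar (∑ i, c i * x i) * ∏ i, residueTheta N (x i) τ := by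
    intro c
    simp_rw [residueTheta_neg_inv _ hτ]
    rw [Finset.prod_mul_distrib, Finset.prod_const, Finset.card_univ, Fintype.card_fin,
      Finset.prod_univ_sum, Fintype.piFinset_univ]
    congr 1
    refine Finset.sum_congr rfl fun x _ => ?_
    rw [Finset.prod_mul_distrib, AddChar.map_sum_eq_prod_map]
  simp_rw [wordTheta, h1]
  rw [← Finset.mul_sum, Finset.sum_comm]
  simp_rw [← Finset.sum_mul, sum_stdAddChar_codewords hC, ite_mul, zero_mul]
  rw [← Finset.sum_filter, Finset.filter_mem_eq_inter, Finset.univ_inter, ← Finset.mul_sum,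
    mul_assoc]

theorem wordTheta_codewords_I_ne_zero (C : Submodule (ZMod N) (Fin n → ZMod N)) :
    wordTheta (codewords C) I ≠ 0 := by
  choose r hr hrI using residueTheta_I_pos (N := N)
  have h : wordTheta (codewords C) I = ((∑ c ∈ codewords C, ∏ i, r (c i) : ℝ) : ℂ) := by
    simp [wordTheta, hrI]
  rw [h, Complex.ofReal_ne_zero]
  refine (Finset.sum_pos (fun c _ => Finset.prod_pos fun i _ => hr _) ⟨0, ?_⟩).ne'
  exact mem_codewords.mpr C.zero_mem

theorem exp_sum_val_sq_eq_one {k : ℕ} [NeZero (2 * k)] {c : Fin n → ZMod (2 * k)}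
    (h : 4 * k ∣ euclWt c) :
    ∏ i, cexp (π * I * ((c i).val : ℂ) ^ 2 / (2 * k : ℕ)) = 1 := by
  have hk : (k : ℂ) ≠ 0 := by
    have := NeZero.ne (2 * k)
    exact_mod_cast (by omega : k ≠ 0)
  have hmod : (4 * k : ℤ) ∣ ∑ i, ((c i).val : ℤ) ^ 2 := by
    have h1 : (4 * k : ℤ) ∣ (euclWt c : ℤ) := by exact_mod_cast h
    rw [← dvd_sub_left h1, euclWt]
    push_cast
    rw [← Finset.sum_sub_distrib]
    refine Finset.dvd_sum fun i _ => ?_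
    have hlt : (c i).val ≤ 2 * k := (ZMod.val_lt (c i)).le
    rcases min_choice (((c i).val : ℤ) ^ 2) (((2 * k - (c i).val : ℕ) : ℤ) ^ 2) with h | h
    · rw [h, sub_self]
      exact dvd_zero _
    · rw [h, Nat.cast_sub hlt]
      refine ⟨(c i).val - k, ?_⟩
      push_cast
      ring
  obtain ⟨m, hm⟩ := hmod
  rw [← Complex.exp_sum, Complex.exp_eq_one_iff]
  refine ⟨m, ?_⟩
  have hm' : ∑ i, ((c i).val : ℂ) ^ 2 = 4 * k * m := by exact_mod_cast hm
  rw [← Finset.sum_div, ← Finset.mul_sum, hm']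
  push_cast
  field_simp
  ring

theorem wordTheta_add_one {k : ℕ} [NeZero (2 * k)] {T : Finset (Fin n → ZMod (2 * k))}
    (h : ∀ c ∈ T, 4 * k ∣ euclWt c) {τ : ℂ} (hτ : 0 < τ.im) :
    wordTheta T (τ + 1) = wordTheta T τ := by
  refine Finset.sum_congr rfl fun c hc => ?_
  simp_rw [residueTheta_add_one (even_two_mul k) _ hτ]
  rw [Finset.prod_mul_distrib, exp_sum_val_sq_eq_one (h c hc), one_mul]

theorem half_cpow_sq (z : ℂ) : (z ^ (1 / 2 : ℂ)) ^ 2 = z := by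
  rw [one_div]
  exact Complex.cpow_nat_inv_pow z two_ne_zero

theorem cpow_pow_mul_card_codewords {C : Submodule (ZMod N) (Fin n → ZMod N)}
    (hC : IsSelfDualCode C) :
    ((-I * (I / N)) ^ (1 / 2 : ℂ)) ^ n * (codewords C).card = 1 := by
  have h := wordTheta_codewords_neg_inv hC (τ := I) (by simp)
  rw [show -1 / I = I by simp [neg_div]] at h
  exact (mul_right_cancel₀ (wordTheta_codewords_I_ne_zero C) (by rw [← h, one_mul]))

theorem eight_dvd_of_wordTheta_add_one {C : Submodule (ZMod N) (Fin n → ZMod N)}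
    (hC : IsSelfDualCode C) (hT : ∀ {τ : ℂ}, 0 < τ.im →
      wordTheta (codewords C) (τ + 1) = wordTheta (codewords C) τ) : 8 ∣ n := by
  have hN' : (N : ℂ) ≠ 0 := by exact_mod_cast NeZero.ne N
  have h0 := wordTheta_codewords_I_ne_zero C
  have h1 := wordTheta_codewords_neg_inv hC (τ := I + 1) (by simp)
  have h2 := wordTheta_codewords_neg_inv hC (τ := (I + 1) / 2) (by simp)
  have hI1 : I + 1 ≠ 0 := fun h => by simpa using congrArg Complex.im h
  have e1 : (-1 / (I + 1)) = (I - 1) / 2 := by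
    field_simp
    linear_combination -I_sq
  have e2 : (-1 / ((I + 1) / 2)) = I - 1 := by
    field_simp
    linear_combination -I_sq
  have t1 := hT (τ := I - 1) (by simp)
  have t2 := hT (τ := (I - 1) / 2) (by simp)
  rw [show (I - 1) / 2 + 1 = (I + 1) / 2 by ring] at t2
  rw [sub_add_cancel] at t1
  rw [e1, hT (by simp)] at h1
  rw [e2, ← t1, t2, h1] at h2
  have h3 := cpow_pow_mul_card_codewords hC
  have su := half_cpow_sq (-I * ((I + 1) / N))
  have sv := half_cpow_sq (-I * ((I + 1) / 2 / N))
  have sw := half_cpow_sq (-I * (I / N))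
  set u := (-I * ((I + 1) / N)) ^ (1 / 2 : ℂ)
  set v := (-I * ((I + 1) / 2 / N)) ^ (1 / 2 : ℂ)
  set w := (-I * (I / N)) ^ (1 / 2 : ℂ)
  set A := ((codewords C).card : ℂ)
  have hA : A ≠ 0 := fun h => by simp [h] at h3
  have hw : w ^ 2 = 1 / N := by
    rw [sw]
    linear_combination -(1 / (N : ℂ)) * I_sq
  have huv : (u * v) ^ n = (w ^ 2) ^ n := by
    have h4 : v ^ n * A * (u ^ n * A) = 1 := by
      refine mul_right_cancel₀ h0 ?_
      rw [one_mul]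
      linear_combination -h2
    refine mul_right_cancel₀ (pow_ne_zero 2 hA) ?_
    rw [mul_pow]
    linear_combination h4 - (w ^ n * A + 1) * h3
  set ρ := u * v * N
  have hρn : ρ ^ n = 1 := by
    rw [mul_pow, huv, hw, ← mul_pow, one_div_mul_cancel hN', one_pow]
  have hρ2 : ρ ^ 2 = -I := by
    have : ρ ^ 2 = u ^ 2 * v ^ 2 * N ^ 2 := by ring
    rw [this, su, sv]
    field_simp
    linear_combination (I + 2) * I_sq
  have ho : orderOf ρ = 2 ^ (2 + 1) := by
    apply orderOf_eq_prime_pow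
    · rw [show (2 : ℕ) ^ 2 = 2 * 2 by norm_num, pow_mul, hρ2, neg_sq, I_sq]
      norm_num
    · rw [show (2 : ℕ) ^ (2 + 1) = 2 * 4 by norm_num, pow_mul, hρ2]
      linear_combination (I ^ 2 - 1) * I_sq
  have := orderOf_dvd_of_pow_eq_one hρn
  rwa [ho] at this

theorem wordTheta_codewords_neg_inv_of_eight_dvd {j : ℕ} (hn : n = 8 * j)
    {C : Submodule (ZMod N) (Fin n → ZMod N)} (hC : IsSelfDualCode C) {τ : ℂ} (hτ : 0 < τ.im) :
    wordTheta (codewords C) (-1 / τ) = τ ^ (4 * j) * wordTheta (codewords C) τ := by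
  rw [wordTheta_codewords_neg_inv hC hτ]
  have h := cpow_pow_mul_card_codewords hC
  congr 1
  have hpow : ∀ x : ℂ, x ^ n = (x ^ 2) ^ (4 * j) := fun x => by
    rw [← pow_mul, hn]
    congr 1
    ring
  rw [hpow, half_cpow_sq] at h ⊢
  rw [show -I * (τ / N) = τ * (-I * (I / N)) * (-I) by
    linear_combination (-I * (τ / N)) * I_sq, mul_pow, mul_pow, pow_mul (-I),
    show (-I) ^ 4 = 1 by linear_combination (I ^ 2 - 1) * I_sq, one_pow, mul_one, mul_assoc, h,
    mul_one]

end CodeTheta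

section ThetaBounds

open Complex Real Function
open UpperHalfPlane hiding I
open scoped Manifold

theorem min_val_sq_le_sq {N : ℕ} [NeZero N] (a : ZMod N) (l : ℤ) :
    ((min (a.val ^ 2) ((N - a.val) ^ 2) : ℕ) : ℝ) ≤ ((a.val : ℝ) + N * l) ^ 2 := by
  have hlt : a.val ≤ N := (ZMod.val_lt a).le
  suffices h : ((min (a.val ^ 2) ((N - a.val) ^ 2) : ℕ) : ℤ) ≤ ((a.val : ℤ) + N * l) ^ 2 by
    exact_mod_cast h
  rcases le_or_gt 0 l with hl | hl
  · refine (Int.ofNat_le.mpr (min_le_left _ _)).trans ?_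
    push_cast
    exact pow_le_pow_left₀ (by positivity) (by nlinarith [Int.natCast_nonneg N]) 2
  · refine (Int.ofNat_le.mpr (min_le_right _ _)).trans ?_
    rw [← neg_sq ((a.val : ℤ) + N * l)]
    push_cast [Nat.cast_sub hlt]
    have h1 : (0 : ℤ) ≤ N - a.val := by
      have : (a.val : ℤ) ≤ N := by exact_mod_cast hlt
      linarith
    exact pow_le_pow_left₀ h1 (by nlinarith [Int.natCast_nonneg N]) 2

theorem exists_norm_residueTheta_le {N : ℕ} [NeZero N] (a : ZMod N) :
    ∃ B : ℝ, 0 ≤ B ∧ ∀ τ : ℂ, 1 ≤ τ.im → ‖residueTheta N a τ‖ ≤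
      B * Real.exp (-(π * (τ.im - 1) / N) * (min (a.val ^ 2) ((N - a.val) ^ 2) : ℕ)) := by
  have hN : (0 : ℝ) < N := by exact_mod_cast Nat.pos_of_ne_zero (NeZero.ne N)
  have hnorm : ∀ (τ : ℂ) (l : ℤ), ‖cexp (π * I * ((a.val : ℂ) + N * l) ^ 2 * τ / N)‖ =
      Real.exp (-(π * ((a.val : ℝ) + N * l) ^ 2 * τ.im / N)) := by
    intro τ l
    rw [Complex.norm_exp]
    congr 1
    have : (π * I * ((a.val : ℂ) + N * l) ^ 2 * τ / N) =
        ((π * ((a.val : ℝ) + N * l) ^ 2 / N : ℝ) : ℂ) * (I * τ) := by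
      push_cast
      ring
    rw [this, Complex.re_ofReal_mul]
    simp
    ring
  have h1 := (hasSum_residueTheta a (τ := I) (by simp)).summable.norm
  simp_rw [hnorm] at h1
  refine ⟨∑' l : ℤ, Real.exp (-(π * ((a.val : ℝ) + N * l) ^ 2 * I.im / N)),
    tsum_nonneg fun l : ℤ => (Real.exp_pos _).le, fun τ hτ => ?_⟩
  have h := hasSum_residueTheta a (τ := τ) (by linarith)
  rw [← h.tsum_eq, ← tsum_mul_right]
  refine (norm_tsum_le_tsum_norm h.summable.norm).trans ?_
  refine h.summable.norm.tsum_le_tsum (fun l => ?_) (h1.mul_right _)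
  rw [hnorm, ← Real.exp_add, Real.exp_le_exp]
  have hm := min_val_sq_le_sq a l
  have hc : 0 ≤ π * (τ.im - 1) / N :=
    div_nonneg (mul_nonneg pi_pos.le (by linarith)) hN.le
  have := mul_le_mul_of_nonneg_left hm hc
  have e : π * ((a.val : ℝ) + N * l) ^ 2 * τ.im / N =
      π * ((a.val : ℝ) + N * l) ^ 2 * I.im / N +
        π * (τ.im - 1) / N * ((a.val : ℝ) + N * l) ^ 2 := by
    rw [Complex.I_im]
    ring
  rw [e]
  linarith

theorem exists_norm_wordTheta_le {N n : ℕ} [NeZero N] (T : Finset (Fin n → ZMod N)) (W : ℕ)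
    (hT : ∀ c ∈ T, W ≤ euclWt c) :
    ∃ B : ℝ, ∀ τ : ℂ, 1 ≤ τ.im →
      ‖wordTheta T τ‖ ≤ B * Real.exp (-(π * (τ.im - 1) / N) * W) := by
  choose B hB0 hB using exists_norm_residueTheta_le (N := N)
  refine ⟨∑ c ∈ T, ∏ i, B (c i), fun τ hτ => ?_⟩
  rw [wordTheta, Finset.sum_mul]
  refine (norm_sum_le _ _).trans (Finset.sum_le_sum fun c hc => ?_)
  rw [norm_prod]
  refine (Finset.prod_le_prod (fun i _ => norm_nonneg _) fun i _ => hB (c i) τ hτ).trans ?_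
  rw [Finset.prod_mul_distrib, ← Real.exp_sum, ← Finset.mul_sum, ← Nat.cast_sum]
  refine mul_le_mul_of_nonneg_left (Real.exp_le_exp.mpr ?_) (Finset.prod_nonneg fun i _ => hB0 _)
  have hc0 : 0 ≤ π * (τ.im - 1) / N :=
    div_nonneg (mul_nonneg pi_pos.le (by linarith)) (Nat.cast_nonneg N)
  have h1 : (W : ℝ) ≤ euclWt c := by exact_mod_cast hT c hc
  have := mul_le_mul_of_nonneg_left h1 hc0
  rw [euclWt] at this
  linarith

theorem mdifferentiable_wordTheta {N n : ℕ} [NeZero N] (T : Finset (Fin n → ZMod N)) :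
    MDiff (fun τ : ℍ => wordTheta T τ) := by
  rw [UpperHalfPlane.mdifferentiable_iff]
  have h : DifferentiableOn ℂ (wordTheta T) {z | 0 < z.im} := fun z hz =>
    (DifferentiableAt.fun_sum fun c _ => DifferentiableAt.fun_finsetProd fun i _ =>
      differentiableAt_residueTheta (c i) hz).differentiableWithinAt
  refine h.congr fun z hz => ?_
  simp only [Function.comp, ofComplex_apply_of_im_pos hz]

theorem isBoundedAtImInfty_wordTheta {N n : ℕ} [NeZero N] (T : Finset (Fin n → ZMod N)) :
    IsBoundedAtImInfty (fun τ : ℍ => wordTheta T τ) := by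
  obtain ⟨B, hB⟩ := exists_norm_wordTheta_le T 0 fun _ _ => Nat.zero_le _
  rw [isBoundedAtImInfty_iff]
  exact ⟨B, 1, fun τ hτ => by simpa using hB τ hτ⟩

theorem periodic_wordTheta {k n : ℕ} [NeZero (2 * k)] {T : Finset (Fin n → ZMod (2 * k))}
    (h : ∀ c ∈ T, 4 * k ∣ euclWt c) :
    Periodic ((fun τ : ℍ => wordTheta T τ) ∘ ofComplex) (1 : ℝ) := by
  intro z
  rcases lt_or_ge 0 z.im with hz | hz
  · have hz' : 0 < (z + (1 : ℝ)).im := by simpa using hz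
    simp only [Function.comp, ofComplex_apply_of_im_pos hz, ofComplex_apply_of_im_pos hz']
    simpa using wordTheta_add_one h hz
  · have hz' : (z + (1 : ℝ)).im ≤ 0 := by simpa using hz
    simp only [Function.comp, ofComplex_apply_of_im_nonpos hz, ofComplex_apply_of_im_nonpos hz']

theorem X_pow_dvd_qExpansion_of_norm_le {f : ℍ → ℂ} (hfper : Periodic (f ∘ ofComplex) (1 : ℝ))
    (hfhol : MDiff f) (hfbdd : IsBoundedAtImInfty f) (s : ℕ) (B : ℝ)
    (hB : ∀ τ : ℍ, 1 ≤ τ.im → ‖f τ‖ ≤ B * Real.exp (-(2 * π * (τ.im - 1)) * (s + 1))) :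
    PowerSeries.X ^ (s + 1) ∣ qExpansion 1 f := by
  rw [PowerSeries.X_pow_dvd_iff]
  intro m hm
  have hbound : ∀ t : ℝ, 1 ≤ t → ‖(qExpansion 1 f).coeff m‖ ≤
      B * Real.exp (2 * π * (s + 1)) * Real.exp (-t) := by
    intro t ht
    have ht0 : 0 < t := by linarith
    rw [UpperHalfPlane.qExpansion_coeff_eq_intervalIntegral one_pos hfper hfhol hfbdd m ht0]
    have key := intervalIntegral.norm_integral_le_of_norm_le_const (a := (0 : ℝ)) (b := 1)
      (C := B * Real.exp (2 * π * (s + 1)) * Real.exp (-t))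
      (f := fun u : ℝ => 1 / Periodic.qParam 1 (u + t * I) ^ m *
        f ⟨u + t * I, by simpa using ht0⟩) fun u _ => ?_
    · simpa using key
    have hfu := hB ⟨u + t * I, by simpa using ht0⟩ (by simpa [UpperHalfPlane.im] using ht)
    have him : UpperHalfPlane.im ⟨(u : ℂ) + t * I, by simpa using ht0⟩ = t := by
      simp [UpperHalfPlane.im]
    rw [him] at hfu
    have hB0 : 0 ≤ B := by
      by_contra hneg
      have := mul_neg_of_neg_of_pos (not_le.mp hneg)
        (Real.exp_pos (-(2 * π * (t - 1)) * (s + 1)))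
      linarith [norm_nonneg (f ⟨u + t * I, by simpa using ht0⟩)]
    rw [norm_mul, norm_div, norm_pow, norm_one, Periodic.norm_qParam, one_div, ← Real.exp_nat_mul,
      ← Real.exp_neg]
    refine (mul_le_mul_of_nonneg_left hfu (Real.exp_pos _).le).trans ?_
    rw [mul_left_comm, ← Real.exp_add, mul_assoc B, ← Real.exp_add]
    refine mul_le_mul_of_nonneg_left (Real.exp_le_exp.mpr ?_) hB0
    have hms : (m : ℝ) ≤ s := by exact_mod_cast Nat.lt_succ_iff.mp hm
    have h1 : π * t * m ≤ π * t * s :=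
      mul_le_mul_of_nonneg_left hms (mul_nonneg pi_pos.le ht0.le)
    have h2 : 1 * t ≤ π * t := mul_le_mul_of_nonneg_right (by linarith [pi_gt_three]) ht0.le
    simp
    nlinarith
  have hlim : Filter.Tendsto (fun t : ℝ => B * Real.exp (2 * π * (s + 1)) * Real.exp (-t))
      Filter.atTop (nhds 0) := by
    simpa using (Real.tendsto_exp_neg_atTop_nhds_zero).const_mul
      (B * Real.exp (2 * π * (s + 1)))
  have := ge_of_tendsto hlim (Filter.eventually_atTop.mpr ⟨1, fun t ht => hbound t ht⟩)
  exact norm_le_zero_iff.mp this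

end ThetaBounds

section ThetaModularForm

open Complex Real Function ModularForm MatrixGroups SlashInvariantForm
open UpperHalfPlane hiding I
open scoped Manifold

theorem isTypeII_dvd_of_mem_codewords {k n : ℕ} [NeZero (2 * k)]
    {C : Submodule (ZMod (2 * k)) (Fin n → ZMod (2 * k))} (hC : IsTypeII k C) :
    ∀ c ∈ codewords C, 4 * k ∣ euclWt c :=
  fun c hc => hC.2 c (mem_codewords.mp hc)

theorem wordTheta_slash_S {N j n : ℕ} [NeZero N] (hn : n = 8 * j)
    {C : Submodule (ZMod N) (Fin n → ZMod N)} (hC : IsSelfDualCode C) :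
    (fun τ : ℍ => wordTheta (codewords C) τ) ∣[(4 * j : ℤ)] ModularGroup.S =
      fun τ : ℍ => wordTheta (codewords C) τ := by
  ext τ
  have h0 : (τ : ℂ) ≠ 0 := τ.ne_zero
  rw [SL_slash_apply, ModularGroup.denom_S, UpperHalfPlane.modular_S_smul]
  have h := wordTheta_codewords_neg_inv_of_eight_dvd hn hC τ.im_pos
  have e : -1 / (τ : ℂ) = (-(τ : ℂ))⁻¹ := by
    rw [neg_div, one_div, inv_neg]
  rw [e] at h
  change wordTheta (codewords C) (-(τ : ℂ))⁻¹ * _ = _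
  have hz : (τ : ℂ) ^ (-(4 * j : ℤ)) = ((τ : ℂ) ^ (4 * j))⁻¹ := by
    rw [zpow_neg]
    norm_cast
  rw [h, hz]
  field_simp

theorem wordTheta_slash_T {k n : ℕ} [NeZero (2 * k)] {T : Finset (Fin n → ZMod (2 * k))}
    (h : ∀ c ∈ T, 4 * k ∣ euclWt c) (w : ℤ) :
    (fun τ : ℍ => wordTheta T τ) ∣[w] ModularGroup.T = fun τ : ℍ => wordTheta T τ := by
  ext τ
  have hd : denom ModularGroup.T τ = 1 := by
    rw [ModularGroup.denom_apply]
    simp [ModularGroup.T]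
  rw [SL_slash_apply, hd, one_zpow, mul_one, UpperHalfPlane.modular_T_smul]
  have e : (((1 : ℝ) +ᵥ τ : ℍ) : ℂ) = (τ : ℂ) + 1 := by
    rw [UpperHalfPlane.coe_vadd, add_comm]
    simp
  simp only [e]
  exact wordTheta_add_one h τ.im_pos

/-- The theta series of a Type II code, as a modular form of level one. -/
noncomputable def typeIITheta {k j n : ℕ} [NeZero (2 * k)] (hn : n = 8 * j)
    {C : Submodule (ZMod (2 * k)) (Fin n → ZMod (2 * k))} (hC : IsTypeII k C) :
    ModularForm 𝒮ℒ (4 * j : ℤ) where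
  toFun := fun τ : ℍ => wordTheta (codewords C) τ
  slash_action_eq' A hA := by
    obtain ⟨A, rfl⟩ := hA
    exact slash_action_generators_SL2Z (wordTheta_slash_S hn hC.1)
      (wordTheta_slash_T (isTypeII_dvd_of_mem_codewords hC) _) A
  holo' := mdifferentiable_wordTheta _
  bdd_at_cusps' hc := by
    rw [Subgroup.IsArithmetic.isCusp_iff_isCusp_SL2Z] at hc
    rw [OnePoint.isBoundedAt_iff_forall_SL2Z hc]
    intro γ _
    rw [slash_action_generators_SL2Z (wordTheta_slash_S hn hC.1)
      (wordTheta_slash_T (isTypeII_dvd_of_mem_codewords hC) _)]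
    exact isBoundedAtImInfty_wordTheta _

theorem analyticAt_cuspFunction_wordTheta {k n : ℕ} [NeZero (2 * k)]
    {T : Finset (Fin n → ZMod (2 * k))} (h : ∀ c ∈ T, 4 * k ∣ euclWt c) :
    AnalyticAt ℂ (cuspFunction 1 fun τ : ℍ => wordTheta T τ) 0 :=
  UpperHalfPlane.analyticAt_cuspFunction_zero one_pos (periodic_wordTheta h)
    (mdifferentiable_wordTheta T) (isBoundedAtImInfty_wordTheta T)

theorem wordTheta_zero {N n : ℕ} [NeZero N] (τ : ℂ) :
    wordTheta ({0} : Finset (Fin n → ZMod N)) τ = residueTheta N 0 τ ^ n := by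
  simp [wordTheta]

theorem euclWt_zero {m n : ℕ} : euclWt (0 : Fin n → ZMod m) = 0 := by
  simp [euclWt]

theorem dvd_euclWt_of_mem_singleton_zero {k n : ℕ} :
    ∀ c ∈ ({0} : Finset (Fin n → ZMod (2 * k))), 4 * k ∣ euclWt c := by
  simp [euclWt_zero]

theorem qExpansion_wordTheta_zero {k : ℕ} [NeZero (2 * k)] (n : ℕ) :
    qExpansion 1 (fun τ : ℍ => wordTheta ({0} : Finset (Fin n → ZMod (2 * k))) τ) =
      qExpansion 1 (fun τ : ℍ => residueTheta (2 * k) 0 τ) ^ n := by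
  induction n with
  | zero =>
    simp_rw [wordTheta_zero, pow_zero]
    exact qExpansion_one 1
  | succ n ih =>
    have h1 := analyticAt_cuspFunction_wordTheta (k := k) (n := n)
      dvd_euclWt_of_mem_singleton_zero
    have h2 := analyticAt_cuspFunction_wordTheta (k := k) (n := 1)
      dvd_euclWt_of_mem_singleton_zero
    have h3 := UpperHalfPlane.qExpansion_mul h1 h2
    rw [ih] at h3
    simp_rw [wordTheta_zero, pow_one] at h3
    rw [pow_succ, ← h3]
    congr 1
    funext τ
    simp [wordTheta_zero, pow_succ]

open Classical in
/-- The power series `1 + 2 ∑_{l ≥ 1} q^(k l²)`. -/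
noncomputable def squareThetaSeries (k : ℕ) : PowerSeries ℝ :=
  PowerSeries.mk fun m => if m = 0 then 1 else if ∃ l : ℕ, k * (l + 1) ^ 2 = m then 2 else 0

theorem hasSum_squareThetaSeries {k : ℕ} [NeZero (2 * k)] (τ : ℍ) :
    HasSum (fun m => ((PowerSeries.coeff m (squareThetaSeries k) : ℝ) : ℂ) •
      Periodic.qParam 1 (τ : ℂ) ^ m) (residueTheta (2 * k) 0 τ) := by
  classical
  have hk0 : k ≠ 0 := by
    have := NeZero.ne (2 * k)
    omega
  have hk : (0 : ℝ) < k := by exact_mod_cast Nat.pos_of_ne_zero hk0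
  set q := Periodic.qParam 1 (τ : ℂ) with hq
  have him : 0 < (((2 * k : ℕ) : ℂ) * τ).im := by
    rw [← Complex.ofReal_natCast, Complex.im_ofReal_mul]
    push_cast
    have : 0 < (τ : ℂ).im := τ.im_pos
    positivity
  have hth : residueTheta (2 * k) 0 τ = jacobiTheta (((2 * k : ℕ) : ℂ) * τ) := by
    simp [residueTheta, jacobiTheta_eq_jacobiTheta₂]
  have hinj : Injective fun l : ℕ => k * (l + 1) ^ 2 := by
    intro a b hab
    have h1 := Nat.eq_of_mul_eq_mul_left (Nat.pos_of_ne_zero hk0) hab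
    have h2 := Nat.pow_left_injective two_ne_zero h1
    omega
  have hterm : ∀ l : ℕ, cexp (π * I * ((l : ℂ) + 1) ^ 2 * (((2 * k : ℕ) : ℂ) * τ)) =
      q ^ (k * (l + 1) ^ 2) := by
    intro l
    rw [hq, Periodic.qParam, ← Complex.exp_nat_mul]
    congr 1
    push_cast
    ring
  have hsum := hasSum_nat_jacobiTheta him
  simp_rw [hterm] at hsum
  have hsum2 : HasSum (fun m : ℕ => if ∃ l : ℕ, k * (l + 1) ^ 2 = m then q ^ m else 0)
      ((jacobiTheta (((2 * k : ℕ) : ℂ) * τ) - 1) / 2) := by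
    rw [← hinj.hasSum_iff]
    · exact hsum.congr_fun fun l => if_pos ⟨l, rfl⟩
    · intro x hx
      exact if_neg hx
  have hsum3 := (hsum2.mul_left 2).add (hasSum_ite_eq (0 : ℕ) (1 : ℂ))
  have e : 2 * ((jacobiTheta (((2 * k : ℕ) : ℂ) * τ) - 1) / 2) + 1 = residueTheta (2 * k) 0 τ := by
    rw [hth]
    ring
  rw [e] at hsum3
  refine hsum3.congr_fun fun m => ?_
  rw [squareThetaSeries, PowerSeries.coeff_mk, smul_eq_mul]
  by_cases hm : m = 0
  · have hne : ¬ ∃ l : ℕ, k * (l + 1) ^ 2 = m := by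
      rintro ⟨l, hl⟩
      rw [hm] at hl
      simp [hk0] at hl
    rw [if_neg hne]
    simp [hm, hk0]
  · rw [if_neg hm, if_neg hm]
    split_ifs <;> simp

theorem coeff_qExpansion_of_hasSum {h : ℝ} (hh : 0 < h) {f : ℍ → ℂ}
    (hf : AnalyticAt ℂ (cuspFunction h f) 0) {c : ℕ → ℂ}
    (hs : ∀ τ : ℍ, HasSum (fun m => c m • Periodic.qParam h (τ : ℂ) ^ m) (f τ)) (m : ℕ) :
    PowerSeries.coeff m (qExpansion h f) = c m := by
  have h1 := (hasFPowerSeriesOnBall_cuspFunction hh hf hs).hasFPowerSeriesAt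
  have h2 := congrArg (FormalMultilinearSeries.coeff · m)
    (h1.eq_formalMultilinearSeries hf.hasFPowerSeriesAt)
  simp only [FormalMultilinearSeries.coeff_ofScalars] at h2
  rw [h2, qExpansion_coeff, div_eq_inv_mul]

theorem qExpansion_residueTheta_zero {k : ℕ} [NeZero (2 * k)] :
    qExpansion 1 (fun τ : ℍ => residueTheta (2 * k) 0 τ) =
      PowerSeries.map Complex.ofRealHom (squareThetaSeries k) := by
  have han : AnalyticAt ℂ (cuspFunction 1 fun τ : ℍ => residueTheta (2 * k) 0 τ) 0 := by
    have h := analyticAt_cuspFunction_wordTheta (k := k) (n := 1)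
      dvd_euclWt_of_mem_singleton_zero
    have e : (fun τ : ℍ => wordTheta ({0} : Finset (Fin 1 → ZMod (2 * k))) τ) =
        fun τ : ℍ => residueTheta (2 * k) 0 τ := by
      funext τ
      rw [wordTheta_zero, pow_one]
    rwa [e] at h
  refine PowerSeries.ext fun m => ?_
  rw [coeff_qExpansion_of_hasSum one_pos han hasSum_squareThetaSeries, PowerSeries.coeff_map,
    Complex.ofRealHom_eq_coe]

theorem X_pow_dvd_qExpansion_typeIITheta_sub {k j n s : ℕ} [NeZero (2 * k)] (hn : n = 8 * j)
    {C : Submodule (ZMod (2 * k)) (Fin n → ZMod (2 * k))} (hC : IsTypeII k C)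
    (hmin : ∀ c ∈ C, c ≠ 0 → 4 * k * (s + 1) ≤ euclWt c) :
    PowerSeries.X ^ (s + 1) ∣ qExpansion 1 (typeIITheta hn hC) -
      PowerSeries.map Complex.ofRealHom (squareThetaSeries k) ^ (8 * j) := by
  have hT := isTypeII_dvd_of_mem_codewords hC
  have hT0 : ∀ c ∈ (codewords C).erase 0, 4 * k ∣ euclWt c := fun c hc =>
    hT c (Finset.mem_of_mem_erase hc)
  have hdecomp : (typeIITheta hn hC : ℍ → ℂ) =
      (fun τ : ℍ => wordTheta ((codewords C).erase 0) τ) +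
        fun τ : ℍ => wordTheta ({0} : Finset (Fin n → ZMod (2 * k))) τ := by
    funext τ
    simp only [Pi.add_apply, wordTheta, Finset.sum_singleton]
    exact (Finset.sum_erase_add _ _ (mem_codewords.mpr C.zero_mem)).symm
  rw [hdecomp, UpperHalfPlane.qExpansion_add (analyticAt_cuspFunction_wordTheta hT0)
    (analyticAt_cuspFunction_wordTheta dvd_euclWt_of_mem_singleton_zero),
    qExpansion_wordTheta_zero, qExpansion_residueTheta_zero, ← hn, add_sub_cancel_right]
  obtain ⟨B, hB⟩ := exists_norm_wordTheta_le ((codewords C).erase 0) (4 * k * (s + 1))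
    fun c hc => hmin c (mem_codewords.mp (Finset.mem_of_mem_erase hc)) (Finset.ne_of_mem_erase hc)
  refine X_pow_dvd_qExpansion_of_norm_le (periodic_wordTheta hT0) (mdifferentiable_wordTheta _)
    (isBoundedAtImInfty_wordTheta _) s B fun τ hτ => ?_
  refine (hB τ hτ).trans (le_of_eq ?_)
  have hk : (k : ℝ) ≠ 0 := by
    have := NeZero.ne (2 * k)
    exact_mod_cast (by omega : k ≠ 0)
  congr 2
  rw [UpperHalfPlane.coe_im]
  push_cast
  field_simp
  ring

end ThetaModularForm

/-- upper bound on the minimum Euclidean weight of Type II ℤ_{2k}-codes, k ≤ 6. -/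
theorem typeII_min_euclWt_bound (k n : ℕ) (hk1 : 1 ≤ k) (hk6 : k ≤ 6)
    (C : Submodule (ZMod (2 * k)) (Fin n → ZMod (2 * k))) (hC : IsTypeII k C) :
    minEuclWt C ≤ 4 * k * (n / 24) + 4 * k := by
  have : NeZero (2 * k) := ⟨by omega⟩
  by_contra! hlt
  have hmin : ∀ c ∈ C, c ≠ 0 → 4 * k * (n / 24 + 1 + 1) ≤ euclWt c := by
    intro c hc hc0
    have h1 : minEuclWt C ≤ euclWt c := Nat.sInf_le ⟨c, hc, hc0, rfl⟩
    obtain ⟨m, hm⟩ := hC.2 c hc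
    rw [hm] at h1 ⊢
    refine Nat.mul_le_mul_left _ (Nat.succ_le_of_lt ?_)
    refine Nat.lt_of_mul_lt_mul_left (a := 4 * k) ?_
    linarith
  obtain ⟨j, hj⟩ : 8 ∣ n := eight_dvd_of_wordTheta_add_one hC.1 fun hτ =>
    wordTheta_add_one (isTypeII_dvd_of_mem_codewords hC) hτ
  have hj0 : 0 < j := by
    rcases Nat.eq_zero_or_pos j with rfl | h
    · have hn0 : n = 0 := hj
      subst hn0
      have hempty : {w | ∃ c ∈ C, c ≠ 0 ∧ euclWt c = w} = ∅ :=
        Set.eq_empty_of_forall_notMem fun w ⟨c, _, hc, _⟩ => hc (Subsingleton.elim c 0)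
      rw [minEuclWt, hempty, Nat.sInf_empty] at hlt
      omega
    · exact h
  refine not_X_pow_dvd_qExpansion_sub_pow hj0 (s := n / 24 + 1) (by omega)
    (typeIITheta hj hC) (G := squareThetaSeries k) ?_ (fun m => ?_) (fun m => ?_)
    (X_pow_dvd_qExpansion_typeIITheta_sub hj hC hmin)
  · simp [squareThetaSeries]
  · rw [squareThetaSeries, PowerSeries.coeff_mk]
    split_ifs <;> norm_num
  · rw [squareThetaSeries, PowerSeries.coeff_mk]
    split_ifs <;> norm_num
end

section
/- There exists an extremal Type II ℤ_{10}-code of length 48, i.e., a Type II ℤ_{10}-code C of length 48 with d_E(C) = 20·⌊48/24⌋ + 20 = 60. -/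
open scoped BigOperators

open Matrix

/-- The negacirculant matrix of order 24 with first row `r`. -/
def negacirculant (r : List ℤ) : Matrix (Fin 24) (Fin 24) ℤ := fun i j =>
  if i ≤ j then r.getD (j - i) 0 else -r.getD (24 + j - i) 0

/-- A conference matrix of order 24 in negacirculant form. -/
def conf : Matrix (Fin 24) (Fin 24) ℤ := negacirculant
  [0, 1, 1, -1, -1, 1, -1, 1, -1, 1, 1, 1, -1, -1, 1, -1, -1, -1, -1, -1, -1, 1, 1, -1]

/-- The reduction of `conf` modulo 3. The rows of `(1 | conf₃)` generate a Pless symmetry code. -/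
def conf₃ : Matrix (Fin 24) (Fin 24) (ZMod 3) := conf.map Int.cast

theorem conf₃_mul_transpose : conf₃ * conf₃.transpose = -1 := by decide +kernel

/-! ### Bit-sliced arithmetic over `ZMod 3` -/

/-- The number whose base-32 digits are the bits `f 0, f 1, …`. -/
def pack : {m : ℕ} → (Fin m → Bool) → ℕ
  | 0, _ => 0
  | _ + 1, f => (f 0).toNat + 32 * pack fun i => f i.succ

theorem pack_bitwise {op : ℕ → ℕ → ℕ} {b : Bool → Bool → Bool} (hb : b false false = false)
    (h : ∀ x y i, (op x y).testBit i = b (x.testBit i) (y.testBit i)) {m : ℕ}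
    (f g : Fin m → Bool) : op (pack f) (pack g) = pack fun i => b (f i) (g i) := by
  induction m with
  | zero => exact Nat.eq_of_testBit_eq fun i => by simp [h, pack, hb]
  | succ m ih =>
    refine Nat.eq_of_testBit_eq fun i => ?_
    have key (c : Bool) (a : ℕ) : (c.toNat + 32 * a).testBit i =
        if i < 5 then c.toNat.testBit i else a.testBit (i - 5) := by
      rw [add_comm]
      exact Nat.testBit_two_pow_mul_add (i := 5) a (by cases c <;> simp) i
    simp only [h, pack, key, ← ih]
    split_ifs
    · cases f 0 <;> cases g 0 <;> rcases i with _ | i <;>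
        simp [hb, Nat.testBit_succ] <;> cases b _ _ <;> simp
    · rfl

theorem pack_mod {m : ℕ} (hm : m < 31) (f : Fin m → Bool) :
    pack f % 31 = (Finset.univ.filter fun i => f i = true).card := by
  have h : pack f ≡ ∑ i, (f i).toNat [MOD 31] := by
    clear hm
    induction m with
    | zero => simp [pack, Nat.ModEq]
    | succ m ih =>
      have := ih fun i => f i.succ
      simp only [Nat.ModEq, pack, Fin.sum_univ_succ] at this ⊢
      omega
  have hs : ∑ i, (f i).toNat = (Finset.univ.filter fun i => f i = true).card := by
    rw [Finset.card_filter]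
    exact Finset.sum_congr rfl fun i _ => by cases f i <;> rfl
  rw [hs] at h
  have hc : (Finset.univ.filter fun i => f i = true).card ≤ m :=
    (Finset.card_le_univ _).trans_eq (Fintype.card_fin m)
  rw [h, Nat.mod_eq_of_lt (by omega)]

/-- The positions of the entries of `v` equal to `a`. -/
def mask (a : ZMod 3) (v : Fin 24 → ZMod 3) : ℕ := pack fun j => decide (v j = a)

/-- Evaluate `n` before passing it to `f`. -/
def force (n : ℕ) (f : ℕ → Bool) : Bool :=
  Nat.rec (motive := fun _ => Bool) (f 0) (fun m _ => f (Nat.succ m)) n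

theorem force_eq (n : ℕ) (f : ℕ → Bool) : force n f = f n := by cases n <;> rfl

/-- Bit-sliced addition over `ZMod 3`. -/
def addMask (p n q m : ℕ) (f : ℕ → ℕ → Bool) : Bool :=
  force (Nat.xor (Nat.lor p m) (Nat.lor n q)) fun t =>
  force (Nat.xor (Nat.lor n m) t) fun p' => force (Nat.xor (Nat.lor p q) t) fun n' => f p' n'

/-- The number of nonzero entries of the sum of two bit-sliced vectors. -/
def addWeight (p n q m : ℕ) : ℕ :=
  Nat.mod (Nat.xor (Nat.lor (Nat.lor p n) (Nat.lor q m)) (Nat.lor (Nat.land p m) (Nat.land n q))) 31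

theorem lor_pack {m : ℕ} (f g : Fin m → Bool) :
    Nat.lor (pack f) (pack g) = pack fun i => f i || g i :=
  pack_bitwise (b := or) rfl Nat.testBit_or f g

theorem land_pack {m : ℕ} (f g : Fin m → Bool) :
    Nat.land (pack f) (pack g) = pack fun i => f i && g i :=
  pack_bitwise (b := and) rfl Nat.testBit_and f g

theorem xor_pack {m : ℕ} (f g : Fin m → Bool) :
    Nat.xor (pack f) (pack g) = pack fun i => f i ^^ g i :=
  pack_bitwise (b := xor) rfl Nat.testBit_xor f g

theorem addMask_mask (x y : Fin 24 → ZMod 3) (f : ℕ → ℕ → Bool) :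
    addMask (mask 1 x) (mask 2 x) (mask 1 y) (mask 2 y) f =
      f (mask 1 (x + y)) (mask 2 (x + y)) := by
  simp only [addMask, force_eq, mask, lor_pack, xor_pack]
  congr 2 <;> ext i
  · exact (by decide : ∀ a b : ZMod 3, ((decide (a = 2) || decide (b = 2)) ^^
      ((decide (a = 1) || decide (b = 2)) ^^ (decide (a = 2) || decide (b = 1)))) =
      decide (a + b = 1)) (x i) (y i)
  · exact (by decide : ∀ a b : ZMod 3, ((decide (a = 1) || decide (b = 1)) ^^
      ((decide (a = 1) || decide (b = 2)) ^^ (decide (a = 2) || decide (b = 1)))) =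
      decide (a + b = 2)) (x i) (y i)

theorem mask_neg (x : Fin 24 → ZMod 3) : mask 1 (-x) = mask 2 x ∧ mask 2 (-x) = mask 1 x := by
  constructor <;> simp only [mask] <;> congr 1 <;> ext i
  · exact (by decide : ∀ a : ZMod 3, decide (-a = 1) = decide (a = 2)) (x i)
  · exact (by decide : ∀ a : ZMod 3, decide (-a = 2) = decide (a = 1)) (x i)

theorem addMask_mask_neg (x y : Fin 24 → ZMod 3) (f : ℕ → ℕ → Bool) :
    addMask (mask 1 x) (mask 2 x) (mask 2 y) (mask 1 y) f =
      f (mask 1 (x - y)) (mask 2 (x - y)) := by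
  rw [← (mask_neg y).1, ← (mask_neg y).2, addMask_mask, sub_eq_add_neg]

theorem lor_mask_mod (x : Fin 24 → ZMod 3) :
    Nat.mod (Nat.lor (mask 1 x) (mask 2 x)) 31 = hammingNorm x := by
  simp only [mask, lor_pack]
  refine (pack_mod (by norm_num) _).trans (congrArg Finset.card (Finset.filter_congr fun i _ => ?_))
  exact (by decide : ∀ a : ZMod 3, (decide (a = 1) || decide (a = 2)) = true ↔ a ≠ 0) (x i)

theorem addWeight_mask (x y : Fin 24 → ZMod 3) :
    addWeight (mask 1 x) (mask 2 x) (mask 1 y) (mask 2 y) = hammingNorm (x + y) := by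
  simp only [addWeight, mask, lor_pack, land_pack, xor_pack]
  refine (pack_mod (by norm_num) _).trans (congrArg Finset.card (Finset.filter_congr fun i _ => ?_))
  exact (by decide : ∀ a b : ZMod 3,
    (((decide (a = 1) || decide (a = 2)) || (decide (b = 1) || decide (b = 2))) ^^
      ((decide (a = 1) && decide (b = 2)) || (decide (a = 2) && decide (b = 1)))) = true ↔
    a + b ≠ 0) (x i) (y i)

theorem addWeight_mask_neg (x y : Fin 24 → ZMod 3) :
    addWeight (mask 1 x) (mask 2 x) (mask 2 y) (mask 1 y) = hammingNorm (x - y) := by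
  rw [← (mask_neg y).1, ← (mask_neg y).2, addWeight_mask, sub_eq_add_neg]

/-- Check that adding to the vector with masks `p`, `n` at most one of the vectors `± L i`
leaves weight at least 8, or 7 if one vector is added. -/
def searchOne (L : List (ℕ × ℕ)) : ℕ → ℕ → Bool :=
  List.rec (motive := fun _ => ℕ → ℕ → Bool) (fun p n => Nat.ble 8 (Nat.mod (Nat.lor p n) 31))
    (fun r _ ih p n => and (Nat.ble 7 (addWeight p n r.1 r.2))
      (and (Nat.ble 7 (addWeight p n r.2 r.1)) (ih p n))) L

/-- Check that adding to the vector with masks `p`, `n` any `m ≤ k + 1` of the vectors `± L i`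
leaves weight at least `8 + k - m`. -/
def search (L : List (ℕ × ℕ)) : ℕ → ℕ → ℕ → Bool :=
  List.rec (motive := fun _ => ℕ → ℕ → ℕ → Bool)
    (fun k p n => Nat.ble (8 + k) (Nat.mod (Nat.lor p n) 31))
    (fun r L ih k p n => Nat.rec (motive := fun _ => Bool) (searchOne (r :: L) p n)
      (fun k' _ => and (ih (Nat.succ k') p n)
        (and (addMask p n r.1 r.2 (ih k')) (addMask p n r.2 r.1 (ih k')))) k) L

theorem card_filter_range_succ (c : ℕ → ZMod 3) (m : ℕ) :
    ((Finset.range (m + 1)).filter fun i => c i ≠ 0).card =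
      (if c 0 ≠ 0 then 1 else 0) + ((Finset.range m).filter fun i => c (i + 1) ≠ 0).card := by
  rw [Finset.card_filter, Finset.sum_range_succ', add_comm, Finset.card_filter]

theorem searchOne_sound (L : List (ℕ × ℕ)) (V : ℕ → Fin 24 → ZMod 3)
    (hL : ∀ i (h : i < L.length), L[i] = (mask 1 (V i), mask 2 (V i))) (x : Fin 24 → ZMod 3)
    (h : searchOne L (mask 1 x) (mask 2 x) = true) (c : ℕ → ZMod 3)
    (hc : ((Finset.range L.length).filter fun i => c i ≠ 0).card ≤ 1) :
    8 ≤ hammingNorm (x + ∑ i ∈ Finset.range L.length, c i • V i) +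
      ((Finset.range L.length).filter fun i => c i ≠ 0).card := by
  induction L generalizing V c with
  | nil =>
    have h' := Nat.le_of_ble_eq_true h
    rw [lor_mask_mod] at h'
    simpa using h'
  | cons r L ih =>
    have hr : r = (mask 1 (V 0), mask 2 (V 0)) := hL 0 (by simp)
    have h' : (Nat.ble 7 (addWeight (mask 1 x) (mask 2 x) r.1 r.2) &&
      (Nat.ble 7 (addWeight (mask 1 x) (mask 2 x) r.2 r.1) &&
        searchOne L (mask 1 x) (mask 2 x))) = true := h
    simp only [hr, addWeight_mask, addWeight_mask_neg, Bool.and_eq_true, Nat.ble_eq] at h'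
    rw [List.length_cons, card_filter_range_succ] at hc ⊢
    rw [Finset.sum_range_succ']
    by_cases h0 : c 0 = 0
    · have := ih (fun i => V (i + 1)) (fun i hi => hL (i + 1) (by simpa using hi)) h'.2.2
        (fun i => c (i + 1)) (by simpa [h0] using hc)
      simpa [h0] using this
    · simp only [h0, ne_eq, not_false_eq_true, if_true] at hc ⊢
      have hz : ((Finset.range L.length).filter fun i => ¬c (i + 1) = 0).card = 0 := by omega
      have hz' : ∑ i ∈ Finset.range L.length, c (i + 1) • V (i + 1) = 0 := by
        refine Finset.sum_eq_zero fun i hi => ?_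
        have : c (i + 1) = 0 := by
          by_contra hne
          exact Finset.notMem_empty i (Finset.card_eq_zero.1 hz ▸ Finset.mem_filter.2 ⟨hi, hne⟩)
        rw [this, zero_smul]
      rw [hz', hz, zero_add]
      obtain h1 | h1 : c 0 = 1 ∨ c 0 = -1 := by
        revert h0; generalize c 0 = a; revert a; decide
      · rw [h1, one_smul]; omega
      · rw [h1, neg_one_smul, ← sub_eq_add_neg]; omega

theorem search_sound (L : List (ℕ × ℕ)) (V : ℕ → Fin 24 → ZMod 3)
    (hL : ∀ i (h : i < L.length), L[i] = (mask 1 (V i), mask 2 (V i))) (k : ℕ)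
    (x : Fin 24 → ZMod 3) (h : search L k (mask 1 x) (mask 2 x) = true) (c : ℕ → ZMod 3)
    (hc : ((Finset.range L.length).filter fun i => c i ≠ 0).card ≤ k + 1) :
    8 + k ≤ hammingNorm (x + ∑ i ∈ Finset.range L.length, c i • V i) +
      ((Finset.range L.length).filter fun i => c i ≠ 0).card := by
  induction L generalizing V c k x with
  | nil =>
    have h' := Nat.le_of_ble_eq_true h
    rw [lor_mask_mod] at h'
    simpa using h'
  | cons r L ih =>
    rcases k with _ | k
    · exact searchOne_sound (r :: L) V hL x h c hc
    have hr : r = (mask 1 (V 0), mask 2 (V 0)) := hL 0 (by simp)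
    have h' : (search L (k + 1) (mask 1 x) (mask 2 x) &&
      (addMask (mask 1 x) (mask 2 x) r.1 r.2 (search L k) &&
        addMask (mask 1 x) (mask 2 x) r.2 r.1 (search L k))) = true := h
    simp only [hr, addMask_mask, addMask_mask_neg, Bool.and_eq_true] at h'
    rw [List.length_cons, card_filter_range_succ] at hc ⊢
    rw [Finset.sum_range_succ', add_comm (Finset.sum _ _), ← add_assoc x]
    simp only [ne_eq] at hc ih ⊢
    have ih' := fun k x h =>
      ih (fun i => V (i + 1)) (fun i hi => hL (i + 1) (by simpa using hi)) k x h
        (fun i => c (i + 1))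
    obtain h0 | h0 | h0 : c 0 = 0 ∨ c 0 = 1 ∨ c 0 = -1 := by
      generalize c 0 = a; revert a; decide
    · have := ih' _ _ h'.1 (by simpa [h0] using hc)
      simp only [h0, not_true_eq_false, if_false, zero_add, zero_smul, add_zero]
      exact this
    · simp only [h0, one_ne_zero, not_false_eq_true, if_true, one_smul] at hc ⊢
      have := ih' _ _ h'.2.1 (by omega)
      omega
    · simp only [h0, neg_eq_zero, one_ne_zero, not_false_eq_true, if_true, neg_one_smul] at hc ⊢
      rw [← sub_eq_add_neg]
      have := ih' _ _ h'.2.2 (by omega)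
      omega

/-! ### The minimum weight of the ternary code -/

/-- `u` generates a codeword `(u, u ᵥ* conf₃)` of small weight, with at most half of the weight
in the first component. -/
def IsSmall (u : Fin 24 → ZMod 3) : Prop :=
  u ≠ 0 ∧ hammingNorm u ≤ 6 ∧ hammingNorm u + hammingNorm (u ᵥ* conf₃) ≤ 12

theorem hammingNorm_eq_of_equiv (e : Equiv.Perm (Fin 24)) {x y : Fin 24 → ZMod 3}
    (h : ∀ j, x (e j) ≠ 0 ↔ y j ≠ 0) : hammingNorm x = hammingNorm y :=
  (Finset.card_equiv e fun j => by simp [h]).symm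

theorem IsSmall.monomial (e : Equiv.Perm (Fin 24)) (d c : Fin 24 → ZMod 3)
    (hd : ∀ j, d j * d j = 1) (hc : ∀ j, c j * c j = 1)
    (h : ∀ j k, conf₃ (e j) (e k) = d j * c k * conf₃ j k) {u : Fin 24 → ZMod 3}
    (hu : IsSmall u) : ∃ u', IsSmall u' ∧ ∀ j, u' (e j) = d j * u j := by
  have hne : ∀ a b : ZMod 3, a * a = 1 → (a * b ≠ 0 ↔ b ≠ 0) := by decide
  refine ⟨fun i => d (e.symm i) * u (e.symm i), ?_, fun j => by simp⟩
  have h1 : hammingNorm (fun i => d (e.symm i) * u (e.symm i)) = hammingNorm u :=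
    hammingNorm_eq_of_equiv e fun j => by simpa using hne _ _ (hd j)
  have h2 : hammingNorm ((fun i => d (e.symm i) * u (e.symm i)) ᵥ* conf₃) =
      hammingNorm (u ᵥ* conf₃) := by
    refine hammingNorm_eq_of_equiv e fun k => ?_
    rw [← hne (c k) ((u ᵥ* conf₃) k) (hc k)]
    have : ((fun i => d (e.symm i) * u (e.symm i)) ᵥ* conf₃) (e k) = c k * (u ᵥ* conf₃) k := by
      simp only [Matrix.vecMul, dotProduct, Finset.mul_sum]
      rw [← Equiv.sum_comp e]
      refine Finset.sum_congr rfl fun j _ => ?_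
      rw [h, Equiv.symm_apply_apply]
      linear_combination (c k * u j * conf₃ j k) * hd j
    rw [this]
  refine ⟨?_, by rw [h1]; exact hu.2.1, by rw [h1, h2]; exact hu.2.2⟩
  rw [← hammingNorm_ne_zero_iff, h1, hammingNorm_ne_zero_iff]
  exact hu.1

theorem IsSmall.monomial_pow (e : Equiv.Perm (Fin 24)) (d c : Fin 24 → ZMod 3)
    (hd : ∀ j, d j * d j = 1) (hc : ∀ j, c j * c j = 1)
    (h : ∀ j k, conf₃ (e j) (e k) = d j * c k * conf₃ j k) {u : Fin 24 → ZMod 3}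
    (hu : IsSmall u) (n : ℕ) : ∃ u', IsSmall u' ∧ ∀ j, u j ≠ 0 → u' (e^[n] j) ≠ 0 := by
  have hne : ∀ a b : ZMod 3, a * a = 1 → b ≠ 0 → a * b ≠ 0 := by decide
  induction n with
  | zero => exact ⟨u, hu, fun j hj => hj⟩
  | succ n ih =>
    obtain ⟨v, hv, hvu⟩ := ih
    obtain ⟨w, hw, hwv⟩ := hv.monomial e d c hd hc h
    refine ⟨w, hw, fun j hj => ?_⟩
    rw [Function.iterate_succ_apply', hwv]
    exact hne _ _ (hd _) (hvu j hj)

/-- The signs of the negacyclic shift. -/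
def shiftSign (j : Fin 24) : ZMod 3 := if j = 23 then -1 else 1

theorem IsSmall.exists_apply_zero {u : Fin 24 → ZMod 3} (hu : IsSmall u) :
    ∃ u', IsSmall u' ∧ u' 0 ≠ 0 := by
  obtain ⟨j, hj⟩ := Function.ne_iff.1 hu.1
  obtain ⟨n, hn⟩ : ∃ n : Fin 24, (Equiv.addRight (1 : Fin 24))^[n] j = 0 := by
    clear hj; revert j; decide +kernel
  obtain ⟨v, hv, hvu⟩ := hu.monomial_pow (Equiv.addRight 1) shiftSign shiftSign
    (by decide) (by decide) (by decide +kernel) n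
  exact ⟨v, hv, hn ▸ hvu j hj⟩

/-- A permutation fixing `0` and permuting the other points cyclically. -/
def fixPerm : Equiv.Perm (Fin 24) where
  toFun := ![0, 16, 21, 22, 5, 14, 12, 15, 23, 17, 19, 7, 18, 6, 8, 2, 10, 13, 11, 20, 3, 4, 9, 1]
  invFun := ![0, 23, 15, 20, 21, 4, 13, 11, 14, 22, 16, 18, 6, 17, 5, 7, 1, 9, 12, 10, 19, 2, 3, 8]
  left_inv := by decide
  right_inv := by decide

/-- The column signs which make `fixPerm` an automorphism of the code. -/
def fixSign : Fin 24 → ZMod 3 :=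
  ![1, -1, 1, -1, -1, 1, 1, -1, 1, -1, -1, 1, 1, 1, -1, -1, -1, 1, -1, 1, 1, -1, 1, -1]

/-- The row signs which make `fixPerm` an automorphism of the code. -/
def fixSign' (j : Fin 24) : ZMod 3 := (-1) ^ ((j : ℕ) + fixPerm j) * fixSign j

theorem IsSmall.exists_apply_zero_one {u : Fin 24 → ZMod 3} (hu : IsSmall u) (h0 : u 0 ≠ 0)
    {j : Fin 24} (h : j ≠ 0) (hj : u j ≠ 0) : ∃ u', IsSmall u' ∧ u' 0 ≠ 0 ∧ u' 1 ≠ 0 := by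
  obtain ⟨n, hn⟩ : ∃ n : Fin 23, fixPerm^[n] j = 1 := by
    clear hj; revert j; decide +kernel
  obtain ⟨v, hv, hvu⟩ := hu.monomial_pow fixPerm fixSign' fixSign
    (by decide) (by decide) (by decide +kernel) n
  have h0' : fixPerm^[n] 0 = 0 := Function.iterate_fixed rfl _
  exact ⟨v, hv, h0' ▸ hvu 0 h0, hn ▸ hvu j hj⟩

theorem search_of_eq {L : List (ℕ × ℕ)} {k p n : ℕ} {x : Fin 24 → ZMod 3}
    (h : search L k p n = true) (hp : mask 1 x = p) (hn : mask 2 x = n) :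
    search L k (mask 1 x) (mask 2 x) = true := by
  rw [hp, hn, h]

/-- The masks of the rows of `conf₃` from the third on. -/
def rowMasks : List (ℕ × ℕ) := [
  (41538374869487584930332267586289696, 1339947575187120647209895648559105),
  (38686844866825502480925696, 42878322405987860710716660753891361),
  (1237979035738416079389622273, 42878321206695669839126083844178976),
  (39615329143629314540467912737, 42878282829345561948227622733382656),
  (1267690532596138065294973207585, 42877054754142109439476867187900416),
  (40566097043076418089439142642721, 42837756347631629159452689732468736),
  (1298115105378445378862052564567073, 41580207339296260198679011158654976),
  (41539683372110252123585682066146337, 1338639072564453453921296796614656),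
  (41872122612195050934765836338208, 42836450322062510525481497491668993),
  (1339907923590241629912506762822657, 41538414521084463911600859453063200),
  (42877053554887732157200216410325025, 1268889786972267420442217677824),
  (42837717971491556126599864850056224, 40604473183112557454150965690369),
  (41578979302813923147388614921454592, 1299343141859601838532830902091809),
  (1299341905129667812628617206202368, 41578980539507258833050588866937889),
  (41578940964149370004115750598475777, 1299381479316409753811783461667872),
  (1298115067863967227896958870880288, 41580207338125112121977070773371905),
  (41539682171646951292702683868169217, 1338639035087714999459204467556384),
  (41833707786568462678823501070368, 42836449122806879982694542961804289),
  (1338678649170190805722352034251777, 41538376144904286542418314497392672),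
  (42837716773446105783115265096056865, 40852021296453579003636220928),
  (41578940965359512155881422793475104, 1307264681486514528116359069697),
  (1298115106588516084398469110858752, 41832469807568464899723490230305)]

theorem rowMasks_eq (i : Fin 22) :
    rowMasks[i]? = some (mask 1 (conf₃ i.succ.succ), mask 2 (conf₃ i.succ.succ)) := by
  revert i
  decide +kernel

theorem search_add :
    search rowMasks 3 (mask 1 (conf₃ 0 + conf₃ 1)) (mask 2 (conf₃ 0 + conf₃ 1)) = true :=
  search_of_eq (p := 1308542516113587721478559760417) (n := 1298074214633706944287321008112640)
    (by decide +kernel) (by decide +kernel) (by decide +kernel)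

theorem search_sub :
    search rowMasks 3 (mask 1 (conf₃ 0 - conf₃ 1)) (mask 2 (conf₃ 0 - conf₃ 1)) = true :=
  search_of_eq (p := 41538374868316401113029532987719712) (n := 40564819208483932503830679257089)
    (by decide +kernel) (by decide +kernel) (by decide +kernel)

theorem not_isSmall_of_apply_one {u : Fin 24 → ZMod 3} (hu : IsSmall u) (h0 : u 0 = 1) :
    u 1 = 0 := by
  by_contra h1
  let c : ℕ → ZMod 3 := fun i => if h : i < 22 then u (Fin.succ (Fin.succ ⟨i, h⟩)) else 0
  let V : ℕ → Fin 24 → ZMod 3 := fun i =>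
    if h : i < 22 then conf₃ (Fin.succ (Fin.succ ⟨i, h⟩)) else 0
  have hL : ∀ i (h : i < rowMasks.length), rowMasks[i] = (mask 1 (V i), mask 2 (V i)) := by
    intro i h
    have h' : i < 22 := h
    have := rowMasks_eq ⟨i, h'⟩
    rw [Fin.getElem?_fin, List.getElem?_eq_getElem h] at this
    simpa [V, h'] using this
  have hlen : rowMasks.length = 22 := rfl
  have hc (i : Fin 22) : c i = u i.succ.succ := by simp [c]; rfl
  have hV (i : Fin 22) : V i = conf₃ i.succ.succ := by simp [V]; rfl
  have hcard : hammingNorm u =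
      2 + ((Finset.range rowMasks.length).filter fun i => c i ≠ 0).card := by
    rw [hammingNorm, Finset.card_filter, Fin.sum_univ_succ, Fin.sum_univ_succ, Finset.card_filter,
      hlen, Finset.sum_range, if_pos (by rw [h0]; decide), if_pos (show u (Fin.succ 0) ≠ 0 from h1),
      ← add_assoc]
    simp only [hc]
  have hsum : u ᵥ* conf₃ =
      conf₃ 0 + u 1 • conf₃ 1 + ∑ i ∈ Finset.range rowMasks.length, c i • V i := by
    rw [hlen, Finset.sum_range, Matrix.vecMul_eq_sum, Fin.sum_univ_succ, Fin.sum_univ_succ, h0,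
      one_smul, ← add_assoc]
    simp only [hc, hV]
    rfl
  obtain ⟨-, h6, h12⟩ := hu
  rw [hsum] at h12
  rw [hcard] at h6 h12
  obtain h | h : u 1 = 1 ∨ u 1 = -1 := by
    revert h1; generalize u 1 = a; revert a; decide
  · have := search_sound rowMasks V hL 3 _ search_add c (by omega)
    rw [h, one_smul] at h12
    omega
  · have := search_sound rowMasks V hL 3 _ search_sub c (by omega)
    rw [h, neg_one_smul, ← sub_eq_add_neg] at h12
    omega

theorem not_isSmall (u : Fin 24 → ZMod 3) : ¬IsSmall u := by
  intro hu
  obtain ⟨u, hu, h0⟩ := hu.exists_apply_zero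
  by_cases h : ∃ j, j ≠ 0 ∧ u j ≠ 0
  · obtain ⟨j, hj, hj'⟩ := h
    obtain ⟨v, hv, hv0, hv1⟩ := hu.exists_apply_zero_one h0 hj hj'
    have hs : v 0 * v 0 = 1 := by revert hv0; generalize v 0 = a; revert a; decide
    obtain ⟨w, hw, hwv⟩ := hv.monomial 1 (fun _ => v 0) (fun _ => v 0) (fun _ => hs) (fun _ => hs)
      fun j k => by simp [hs]
    have := not_isSmall_of_apply_one hw ((hwv 0).trans hs)
    rw [show (1 : Fin 24) = (1 : Equiv.Perm (Fin 24)) 1 from rfl, hwv 1] at this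
    exact mul_ne_zero hv0 hv1 this
  · push Not at h
    have hu' : u = Pi.single 0 (u 0) := by
      ext j
      by_cases hj : j = 0
      · subst hj; simp
      · rw [h j hj, Pi.single_eq_of_ne hj]
    have hall : ∀ a : ZMod 3, a ≠ 0 → 12 < hammingNorm (a • conf₃ 0) := by decide +kernel
    have h12 := hu.2.2
    have h13 := hall _ h0
    rw [hu', Matrix.single_vecMul] at h12
    have : conf₃.row 0 = conf₃ 0 := rfl
    rw [this] at h12
    omega

/-- Alternating signs, which conjugate `conf` to the negative of its transpose. -/
def alternate : Matrix (Fin 24) (Fin 24) (ZMod 3) := Matrix.diagonal fun i => (-1) ^ (i : ℕ)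

theorem alternate_mul_conf₃ : alternate * conf₃ = -(conf₃.transpose * alternate) := by
  decide +kernel

theorem hammingNorm_vecMul_alternate (u : Fin 24 → ZMod 3) :
    hammingNorm (u ᵥ* alternate) = hammingNorm u := by
  refine hammingNorm_eq_of_equiv 1 fun j => ?_
  rw [alternate, Matrix.vecMul_diagonal]
  simp

/-- The ternary code has minimum weight at least 13. -/
theorem thirteen_le_hammingNorm {u : Fin 24 → ZMod 3} (hu : u ≠ 0) :
    13 ≤ hammingNorm u + hammingNorm (u ᵥ* conf₃) := by
  by_contra! hlt
  by_cases h6 : hammingNorm u ≤ 6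
  · exact not_isSmall u ⟨hu, h6, by omega⟩
  have hv : (u ᵥ* conf₃ ᵥ* alternate) ᵥ* conf₃ = u ᵥ* alternate := by
    rw [Matrix.vecMul_vecMul, alternate_mul_conf₃, Matrix.vecMul_vecMul, Matrix.mul_neg,
      ← Matrix.mul_assoc, conf₃_mul_transpose]
    simp
  have h1 := hammingNorm_vecMul_alternate (u ᵥ* conf₃)
  have h2 := hammingNorm_vecMul_alternate u
  refine not_isSmall (u ᵥ* conf₃ ᵥ* alternate) ⟨?_, by omega, by rw [hv]; omega⟩
  intro h0
  rw [h0, Matrix.zero_vecMul] at hv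
  rw [← hv, hammingNorm_zero] at h2
  omega

/-! ### The words of full weight in the ternary code -/

/-- The generator map `u ↦ (u, u ᵥ* S)` of a code. -/
def encode {R : Type*} [CommRing R] (S : Matrix (Fin 24) (Fin 24) R) :
    (Fin 24 → R) →ₗ[R] Fin 24 ⊕ Fin 24 → R where
  toFun u := Sum.elim u (u ᵥ* S)
  map_add' u v := by ext (i | i) <;> simp [Matrix.add_vecMul]
  map_smul' a u := by ext (i | i) <;> simp [Matrix.smul_vecMul]

theorem encode_apply {R : Type*} [CommRing R] (S : Matrix (Fin 24) (Fin 24) R) (u : Fin 24 → R) :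
    encode S u = Sum.elim u (u ᵥ* S) := rfl

theorem encode_dotProduct_encode {R : Type*} [CommRing R] {S : Matrix (Fin 24) (Fin 24) R}
    (hS : S * S.transpose = -1) (u v : Fin 24 → R) : encode S u ⬝ᵥ encode S v = 0 := by
  rw [encode_apply, encode_apply, sumElim_dotProduct_sumElim, ← Matrix.dotProduct_mulVec,
    Matrix.mulVec_vecMul, hS]
  simp [Matrix.neg_mulVec]

theorem transpose_mul_of_mul_transpose {R : Type*} [CommRing R]
    {S : Matrix (Fin 24) (Fin 24) R} (hS : S * S.transpose = -1) : S.transpose * S = -1 := by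
  rw [← neg_eq_iff_eq_neg, ← Matrix.neg_mul, mul_eq_one_comm, Matrix.mul_neg, hS, neg_neg]

theorem exists_eq_encode {R : Type*} [CommRing R] {S : Matrix (Fin 24) (Fin 24) R}
    (hS : S * S.transpose = -1) {x : Fin 24 ⊕ Fin 24 → R} (h : ∀ u, x ⬝ᵥ encode S u = 0) :
    ∃ v, x = encode S v := by
  have hx : ∀ u, (x ∘ Sum.inl + S *ᵥ (x ∘ Sum.inr)) ⬝ᵥ u = 0 := by
    intro u
    have := h u
    rw [encode_apply, ← Sum.elim_comp_inl_inr x, sumElim_dotProduct_sumElim] at this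
    rw [add_dotProduct, dotProduct_comm (S *ᵥ _), Matrix.dotProduct_mulVec,
      dotProduct_comm (u ᵥ* _)]
    exact this
  have hinr : (x ∘ Sum.inl) ᵥ* S = x ∘ Sum.inr := by
    rw [eq_neg_of_add_eq_zero_left (dotProduct_eq_zero _ hx), ← Matrix.vecMul_transpose,
      Matrix.neg_vecMul, Matrix.vecMul_vecMul, transpose_mul_of_mul_transpose hS,
      Matrix.vecMul_neg, Matrix.vecMul_one, neg_neg]
  exact ⟨x ∘ Sum.inl, by rw [encode_apply, hinr, Sum.elim_comp_inl_inr]⟩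

theorem hammingNorm_encode (u : Fin 24 → ZMod 3) :
    hammingNorm (encode conf₃ u) = hammingNorm u + hammingNorm (u ᵥ* conf₃) := by
  rw [hammingNorm, Finset.card_filter, Fintype.sum_sum_type, ← Finset.card_filter,
    ← Finset.card_filter]
  rfl

theorem thirteen_le_hammingNorm_encode {u : Fin 24 → ZMod 3} (hu : u ≠ 0) :
    13 ≤ hammingNorm (encode conf₃ u) :=
  (thirteen_le_hammingNorm hu).trans_eq (hammingNorm_encode u).symm

theorem natCast_hammingNorm {ι : Type*} [Fintype ι] (x : ι → ZMod 3) :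
    (hammingNorm x : ZMod 3) = x ⬝ᵥ x := by
  have h : ∀ a : ZMod 3, (if a ≠ 0 then 1 else 0) = a * a := by decide
  simp only [hammingNorm, Finset.card_filter, Nat.cast_sum, Nat.cast_ite, Nat.cast_one,
    Nat.cast_zero, h, dotProduct]

theorem three_dvd_hammingNorm_encode (u : Fin 24 → ZMod 3) : 3 ∣ hammingNorm (encode conf₃ u) := by
  rw [← ZMod.natCast_eq_zero_iff, natCast_hammingNorm,
    encode_dotProduct_encode conf₃_mul_transpose]

theorem card_encode_eq_zero (J : Finset (Fin 24 ⊕ Fin 24)) (hJ : J.card ≤ 12) :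
    (Finset.univ.filter fun u => ∀ i ∈ J, encode conf₃ u i = 0).card = 3 ^ (24 - J.card) := by
  let f := LinearMap.funLeft (ZMod 3) (ZMod 3) ((↑) : J → Fin 24 ⊕ Fin 24) ∘ₗ encode conf₃
  have hf : LinearMap.range f = ⊤ := by
    by_contra hne
    obtain ⟨g, hg, hfg⟩ := Submodule.exists_le_ker_of_lt_top _ (lt_top_iff_ne_top.2 hne)
    let x : Fin 24 ⊕ Fin 24 → ZMod 3 := fun i => if h : i ∈ J then g (Pi.single ⟨i, h⟩ 1) else 0
    have hgx (v : J → ZMod 3) : g v = ∑ i : J, x i * v i := by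
      rw [LinearMap.pi_apply_eq_sum_univ]
      refine Finset.sum_congr rfl fun i _ => ?_
      simp only [x, i.2, dif_pos, smul_eq_mul, mul_comm]
      congr
      ext j
      simp [Pi.single_apply, eq_comm]
    obtain ⟨v, hv⟩ : ∃ v, x = encode conf₃ v := by
      refine exists_eq_encode conf₃_mul_transpose fun u => ?_
      have : g (f u) = 0 := hfg ⟨u, rfl⟩
      rw [hgx] at this
      rw [dotProduct, ← Finset.sum_subset (Finset.subset_univ J) fun i _ hi => by simp [x, hi],
        ← Finset.sum_coe_sort]
      exact this
    have hv0 : v = 0 := by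
      by_contra hv0
      have h13 := thirteen_le_hammingNorm_encode hv0
      have : hammingNorm (encode conf₃ v) ≤ J.card := by
        rw [← hv]
        refine Finset.card_le_card fun i hi => ?_
        by_contra hiJ
        simp [x, hiJ] at hi
      omega
    rw [hv0, map_zero] at hv
    exact hg (LinearMap.ext fun w => by simp [hgx, hv])
  have hk := LinearMap.finrank_range_add_finrank_ker f
  rw [hf, finrank_top, Module.finrank_fintype_fun_eq_card, Module.finrank_fintype_fun_eq_card,
    Fintype.card_coe, Fintype.card_fin] at hk
  have hc := Module.natCard_eq_pow_finrank (K := ZMod 3) (V := LinearMap.ker f)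
  rw [Nat.card_zmod, show Module.finrank (ZMod 3) (LinearMap.ker f) = 24 - J.card by omega] at hc
  rw [← hc]
  exact (Nat.subtype_card _ fun u => by simp [f, funext_iff]).symm

theorem sum_choose (k : ℕ) (hk : k ≤ 12) :
    ∑ u, (48 - hammingNorm (encode conf₃ u)).choose k = Nat.choose 48 k * 3 ^ (24 - k) := by
  have h (u : Fin 24 → ZMod 3) : (48 - hammingNorm (encode conf₃ u)).choose k =
      ∑ J ∈ Finset.powersetCard k Finset.univ, if ∀ i ∈ J, encode conf₃ u i = 0 then 1 else 0 := by
    have hz : (Finset.univ.filter fun i => encode conf₃ u i = 0).card =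
        48 - hammingNorm (encode conf₃ u) := by
      exact Nat.eq_sub_of_add_eq (Finset.card_filter_add_card_filter_not _)
    rw [← hz, ← Finset.card_powersetCard, ← Finset.card_filter]
    congr 1
    ext J
    simp [Finset.mem_powersetCard, Finset.subset_iff, and_comm]
  simp only [h]
  rw [Finset.sum_comm]
  have hJ : ∀ J ∈ Finset.powersetCard k (Finset.univ : Finset (Fin 24 ⊕ Fin 24)),
      ∑ u, (if ∀ i ∈ J, encode conf₃ u i = 0 then 1 else 0) = 3 ^ (24 - k) := by
    intro J hJ
    rw [← Finset.card_filter]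
    obtain rfl := (Finset.mem_powersetCard.1 hJ).2
    exact card_encode_eq_zero J hk
  rw [Finset.sum_congr rfl hJ]
  simp

/-- The polynomial `∏ k ∈ {1, …, 11}, (X - 3 k)` in the basis of binomial coefficients. -/
def annihilator (n : ℕ) : ℤ :=
  ∑ k : Fin 12, ![-7071141369600, 4746591942400, -2950314259200, 1682308320000, -869931955200,
    401982873600, -162780710400, 56229465600, -15926803200, 3472761600, -518918400, 39916800] k *
    n.choose k

theorem card_full : (Finset.univ.filter fun u => ∀ i, encode conf₃ u i ≠ 0).card = 96 := by
  have hann (u : Fin 24 → ZMod 3) : annihilator (48 - hammingNorm (encode conf₃ u)) =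
      annihilator 0 * (if ∀ i, encode conf₃ u i ≠ 0 then 1 else 0) +
        annihilator 48 * (if u = 0 then 1 else 0) := by
    by_cases hu : u = 0
    · have : ¬∀ i, encode conf₃ u i ≠ 0 := fun h => h (Sum.inl 0) (by simp [hu])
      rw [if_neg this, if_pos hu, hu, map_zero, hammingNorm_zero]
      simp
    have h13 := thirteen_le_hammingNorm_encode hu
    have h3 := three_dvd_hammingNorm_encode u
    have h48 : hammingNorm (encode conf₃ u) = 48 ↔ ∀ i, encode conf₃ u i ≠ 0 := by
      rw [hammingNorm, show 48 = (Finset.univ : Finset (Fin 24 ⊕ Fin 24)).card from rfl,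
        Finset.card_filter_eq_iff]
      simp
    have hle : hammingNorm (encode conf₃ u) ≤ 48 := hammingNorm_le_card_fintype
    have key : ∀ n : Fin 49, 13 ≤ (n : ℕ) → 3 ∣ (n : ℕ) →
        annihilator (48 - n) = annihilator 0 * if (n : ℕ) = 48 then 1 else 0 := by
      decide +kernel
    simpa [hu, h48] using key ⟨_, Nat.lt_succ_of_le hle⟩ h13 h3
  have hsum : ∑ u, annihilator (48 - hammingNorm (encode conf₃ u)) = 8973278398022400 := by
    simp only [annihilator]
    rw [Finset.sum_comm]
    have (k : Fin 12) : ∑ u, ((48 - hammingNorm (encode conf₃ u)).choose k : ℤ) =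
        (Nat.choose 48 k * 3 ^ (24 - k : ℕ) : ℕ) := by
      rw [← sum_choose k (by omega), Nat.cast_sum]
    simp only [← Finset.mul_sum, this]
    decide +kernel
  simp only [hann, Finset.sum_add_distrib, ← Finset.mul_sum] at hsum
  rw [Finset.sum_ite_eq', if_pos (Finset.mem_univ _), Finset.sum_boole,
    show annihilator 0 = -7071141369600 by decide +kernel,
    show annihilator 48 = 9652107969504000 by decide +kernel] at hsum
  omega

/-- The information parts of the codewords of full weight. -/
def fullWord (p : Fin 24 × Fin 2 × Fin 2) : Fin 24 → ZMod 3 :=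
  (-1) ^ (p.2.1 : ℕ) • (Pi.single p.1 1 + (-1) ^ (p.2.2 : ℕ) • conf₃.transpose p.1)

theorem fullWord_injective : Function.Injective fullWord := by
  have : ∀ p q, Nat.ofDigits 3 (List.ofFn fun i => (fullWord p i).val) =
      Nat.ofDigits 3 (List.ofFn fun i => (fullWord q i).val) → p = q := by
    decide +kernel
  exact fun p q h => this p q (by rw [h])

theorem encode_fullWord (p) : encode conf₃ (fullWord p) = Sum.elim (fullWord p)
    ((-1) ^ (p.2.1 : ℕ) • (conf₃ p.1 - (-1) ^ (p.2.2 : ℕ) • Pi.single p.1 1)) := by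
  have h : conf₃.transpose p.1 ᵥ* conf₃ = -Pi.single p.1 1 := by
    rw [← Matrix.mul_apply_eq_vecMul, transpose_mul_of_mul_transpose conf₃_mul_transpose]
    ext j
    simp [Matrix.one_apply, Pi.single_apply, eq_comm]
  rw [encode_apply, fullWord, Matrix.smul_vecMul, Matrix.add_vecMul, Matrix.smul_vecMul, h,
    Matrix.single_one_vecMul, smul_neg, ← sub_eq_add_neg]
  rfl

theorem encode_fullWord_ne_zero (p) : ∀ i, encode conf₃ (fullWord p) i ≠ 0 := by
  rw [encode_fullWord]
  revert p
  decide +kernel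

theorem four_dvd_sum_encode_fullWord (p) :
    4 ∣ ∑ i, (encode conf₃ (fullWord p) i).valMinAbs := by
  rw [encode_fullWord]
  revert p
  decide +kernel

theorem four_dvd_sum_valMinAbs {u : Fin 24 → ZMod 3} (hu : ∀ i, encode conf₃ u i ≠ 0) :
    4 ∣ ∑ i, (encode conf₃ u i).valMinAbs := by
  have himage : Finset.univ.image fullWord =
      Finset.univ.filter fun u => ∀ i, encode conf₃ u i ≠ 0 := by
    refine Finset.eq_of_subset_of_card_le ?_ ?_
    · intro u hu
      obtain ⟨p, -, rfl⟩ := Finset.mem_image.1 hu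
      simpa using encode_fullWord_ne_zero p
    · rw [card_full, Finset.card_image_of_injective _ fullWord_injective]
      rfl
  have : u ∈ Finset.univ.image fullWord := by simpa [himage] using hu
  obtain ⟨p, -, rfl⟩ := Finset.mem_image.1 this
  exact four_dvd_sum_encode_fullWord p

/-! ### An extremal even unimodular lattice -/

/-- The reduction of an integral vector modulo 3. -/
def mod₃ (y : Fin 24 ⊕ Fin 24 → ℤ) (i : Fin 24 ⊕ Fin 24) : ZMod 3 := y i

/-- An extremal even unimodular lattice, scaled by `√12`. -/
def lattice : AddSubgroup (Fin 24 ⊕ Fin 24 → ℤ) where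
  carrier := {y | (∀ i, 2 ∣ y i - y (Sum.inl 0)) ∧ 4 ∣ ∑ i, y i - 2 * y (Sum.inl 0) ∧
    mod₃ y = encode conf₃ (mod₃ y ∘ Sum.inl)}
  zero_mem' := by
    refine ⟨by simp, by simp, ?_⟩
    have h : mod₃ 0 = 0 := by ext i; simp [mod₃]
    rw [h, show (0 : Fin 24 ⊕ Fin 24 → ZMod 3) ∘ Sum.inl = 0 from rfl, map_zero]
  add_mem' := by
    rintro x y ⟨hx1, hx2, hx3⟩ ⟨hy1, hy2, hy3⟩
    refine ⟨fun i => ?_, ?_, ?_⟩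
    · have := dvd_add (hx1 i) (hy1 i)
      rwa [sub_add_sub_comm] at this
    · have := dvd_add hx2 hy2
      simpa only [Pi.add_apply, Finset.sum_add_distrib, mul_add, sub_add_sub_comm] using this
    · have h : mod₃ (x + y) = mod₃ x + mod₃ y := by ext i; simp [mod₃]
      rw [h, Pi.add_comp, map_add, ← hx3, ← hy3]
  neg_mem' := by
    rintro x ⟨hx1, hx2, hx3⟩
    refine ⟨fun i => ?_, ?_, ?_⟩
    · simpa only [Pi.neg_apply, neg_sub_neg, ← neg_sub (x i), dvd_neg] using hx1 i
    · simpa only [Pi.neg_apply, Finset.sum_neg_distrib, mul_neg, neg_sub_neg,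
        ← neg_sub (∑ i, x i), dvd_neg] using hx2
    · have h : mod₃ (-x) = -mod₃ x := by ext i; simp [mod₃]
      rw [h, Pi.neg_comp, map_neg, ← hx3]

section lattice

variable {y : Fin 24 ⊕ Fin 24 → ℤ}

theorem eight_dvd_dotProduct_self (hy : y ∈ lattice) : 8 ∣ y ⬝ᵥ y := by
  obtain ⟨h2, h4, -⟩ := hy
  rcases Int.even_or_odd' (y (Sum.inl 0)) with ⟨k, hk | hk⟩
  · have : 8 ∣ ∑ i, (y i * y i - 2 * y i) := by
      refine Finset.dvd_sum fun i _ => ?_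
      obtain ⟨a, ha⟩ := h2 i
      obtain ⟨b, hb⟩ := Int.even_mul_pred_self (a + k)
      exact ⟨b, by rw [show y i = 2 * (a + k) by omega]; linear_combination 4 * hb⟩
    rw [Finset.sum_sub_distrib, ← Finset.mul_sum] at this
    rw [dotProduct]
    omega
  · have : 8 ∣ ∑ i, (y i * y i - 1) := by
      refine Finset.dvd_sum fun i _ => ?_
      obtain ⟨a, ha⟩ := h2 i
      obtain ⟨b, hb⟩ := Int.even_mul_succ_self (a + k)
      exact ⟨b, by rw [show y i = 2 * (a + k) + 1 by omega]; linear_combination 4 * hb⟩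
    rw [Finset.sum_sub_distrib] at this
    simp only [Finset.sum_const, Finset.card_univ, Fintype.card_sum, Fintype.card_fin,
      nsmul_eq_mul] at this
    rw [dotProduct]
    omega

theorem three_dvd_dotProduct_self (hy : y ∈ lattice) : 3 ∣ y ⬝ᵥ y := by
  refine (ZMod.intCast_zmod_eq_zero_iff_dvd _ 3).1 ?_
  have h : ((y ⬝ᵥ y : ℤ) : ZMod 3) = mod₃ y ⬝ᵥ mod₃ y := by simp [dotProduct, mod₃]
  rw [h, hy.2.2, encode_dotProduct_encode conf₃_mul_transpose]

theorem twentyfour_dvd_dotProduct_self (hy : y ∈ lattice) : 24 ∣ y ⬝ᵥ y := by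
  have := eight_dvd_dotProduct_self hy
  have := three_dvd_dotProduct_self hy
  omega

theorem lt_dotProduct_self_of_even (hy : y ∈ lattice) (h0 : y ≠ 0) (h : Even (y (Sum.inl 0))) :
    48 < y ⬝ᵥ y := by
  have h24 := twentyfour_dvd_dotProduct_self hy
  obtain ⟨h2, -, h3⟩ := hy
  have he (i) : 2 ∣ y i := (dvd_sub_left h.two_dvd).1 (h2 i)
  by_cases hu : mod₃ y ∘ Sum.inl = 0
  · rw [hu, map_zero] at h3
    have h6 (i) : 6 ∣ y i := by
      have := he i
      have : (3 : ℤ) ∣ y i := (ZMod.intCast_zmod_eq_zero_iff_dvd _ 3).1 (congrFun h3 i)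
      omega
    have h36 : 36 ∣ y ⬝ᵥ y := Finset.dvd_sum fun i _ => mul_dvd_mul (h6 i) (h6 i)
    have hpos : 0 < y ⬝ᵥ y := by
      refine lt_of_le_of_ne (Finset.sum_nonneg fun i _ => mul_self_nonneg _) fun h => h0 ?_
      exact dotProduct_self_eq_zero.1 h.symm
    omega
  · have h13 := thirteen_le_hammingNorm_encode hu
    rw [← h3] at h13
    have : 4 * (hammingNorm (mod₃ y) : ℤ) ≤ y ⬝ᵥ y := by
      rw [hammingNorm, Finset.card_filter, Nat.cast_sum, Finset.mul_sum]
      refine Finset.sum_le_sum fun i _ => ?_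
      split_ifs with hi
      · obtain ⟨a, ha⟩ := he i
        have : a ≠ 0 := by rintro rfl; simp [mod₃, ha] at hi
        have := Int.one_le_abs this
        have := abs_mul_abs_self a
        rw [ha]
        push_cast
        nlinarith
      · simpa using mul_self_nonneg (y i)
    omega

theorem lt_dotProduct_self_of_odd (hy : y ∈ lattice) (h : Odd (y (Sum.inl 0))) :
    48 < y ⬝ᵥ y := by
  obtain ⟨h2, h4, h3⟩ := hy
  have ho (i) : y i ≠ 0 := by
    rintro hi
    have := h2 i
    obtain ⟨k, hk⟩ := h
    omega
  have h1 (i) : 0 ≤ y i * y i - 1 := by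
    have := mul_self_pos.2 (ho i)
    omega
  have hsum : ∑ i, (y i * y i - 1) = y ⬝ᵥ y - 48 := by
    simp [Finset.sum_sub_distrib, dotProduct]
  have hne : ∑ i, (y i * y i - 1) ≠ 0 := by
    intro hs
    have hpm (i) : y i = 1 ∨ y i = -1 := by
      have := (Finset.sum_eq_zero_iff_of_nonneg fun i _ => h1 i).1 hs i (Finset.mem_univ i)
      exact mul_self_eq_one_iff.1 (sub_eq_zero.1 this)
    have hz (i) : mod₃ y i ≠ 0 := by
      rcases hpm i with hi | hi <;> rw [mod₃, hi] <;> decide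
    have hv (i) : (mod₃ y i).valMinAbs = y i := by
      rcases hpm i with hi | hi <;> rw [mod₃, hi] <;> decide
    rw [h3] at hz
    have hd := four_dvd_sum_valMinAbs hz
    simp only [← h3, hv] at hd
    obtain ⟨k, hk⟩ := h
    omega
  have := lt_of_le_of_ne (Finset.sum_nonneg fun i _ => h1 i) hne.symm
  omega

theorem le_dotProduct_self (hy : y ∈ lattice) (h0 : y ≠ 0) : 72 ≤ y ⬝ᵥ y := by
  have h24 := twentyfour_dvd_dotProduct_self hy
  have : 48 < y ⬝ᵥ y := (Int.even_or_odd _).elim (lt_dotProduct_self_of_even hy h0)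
    (lt_dotProduct_self_of_odd hy)
  omega

end lattice

/-! ### A 10-frame in the lattice and the corresponding code -/

/-- The first block of `frame`. -/
def frameA : Matrix (Fin 24) (Fin 24) ℤ := negacirculant
  [1, 1, -1, 0, -1, 1, -1, 1, 1, 1, 1, -1, 0, 0, -1, 1, 1, -1, -1, 0, -1, -1, 0, -1]

/-- The second block of `frame`. -/
def frameB : Matrix (Fin 24) (Fin 24) ℤ := negacirculant
  [-1, 0, 0, 1, 0, -1, 0, 0, 1, 0, 0, 1, 0, 0, 0, 0, 0, -1, 0, -1, 1, -1, -1, 1]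

/-- Twice the rows of this matrix are pairwise orthogonal vectors of the lattice. -/
def frame : Matrix (Fin 24 ⊕ Fin 24) (Fin 24 ⊕ Fin 24) ℤ :=
  Matrix.fromBlocks frameA frameB (-frameB.transpose) frameA.transpose

theorem frame_mul_transpose : frame * frame.transpose = (30 : ℤ) • 1 := by
  have h1 : frameA * frameA.transpose + frameB * frameB.transpose = (30 : ℤ) • 1 := by
    decide +kernel
  have h2 : frameB.transpose * frameB + frameA.transpose * frameA = (30 : ℤ) • 1 := by
    decide +kernel
  have h3 : frameA * frameB = frameB * frameA := by decide +kernel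
  have h4 : frameB.transpose * frameA.transpose = frameA.transpose * frameB.transpose := by
    rw [← Matrix.transpose_mul, h3, Matrix.transpose_mul]
  rw [frame, Matrix.fromBlocks_transpose, Matrix.fromBlocks_multiply, ← Matrix.fromBlocks_one,
    Matrix.fromBlocks_smul]
  simp [h1, h2, h3, h4]

/-- The matrix such that `(1 | gen)` generates the code modulo 10. -/
def gen : Matrix (Fin 24) (Fin 24) ℤ := negacirculant
  [-3, -1, -3, 5, 1, 3, -3, 1, -1, -2, 4, -2, -1, -1, -3, -3, 3, 1, -1, 1, -3, -4, -3, 2]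

/-- The reduction of `gen` modulo 10. -/
def gen₁₀ : Matrix (Fin 24) (Fin 24) (ZMod 10) := gen.map Int.cast

theorem gen₁₀_mul_transpose : gen₁₀ * gen₁₀.transpose = -1 := by decide +kernel

/-- Generators of the preimage of the code in `ℤ⁴⁸`. -/
def liftGen : Matrix (Fin 24 ⊕ Fin 24) (Fin 24 ⊕ Fin 24) ℤ :=
  Matrix.fromBlocks 1 gen 0 ((10 : ℤ) • 1)

/-- The first block of `latticeGen`. -/
def latticeGenA : Matrix (Fin 24) (Fin 24) ℤ := negacirculant
  [-1, -1, -1, 1, 1, 1, -1, 1, -1, 1, -1, 3, -1, -1, 1, -3, 1, 1, 1, 1, 1, -1, -3, 1]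

/-- The second block of `latticeGen`. -/
def latticeGenB : Matrix (Fin 24) (Fin 24) ℤ := negacirculant
  [3, -1, 1, 1, 1, -3, -3, 1, 1, 3, 1, 1, -5, -3, -1, -1, 3, 1, -1, -3, -1, -3, -3, 5]

/-- The vectors of the lattice whose coordinates with respect to `frame` form `liftGen`, up to
a factor 5. -/
def latticeGen : Matrix (Fin 24 ⊕ Fin 24) (Fin 24 ⊕ Fin 24) ℤ :=
  Matrix.fromBlocks latticeGenA latticeGenB ((-2 : ℤ) • frameB.transpose)
    ((2 : ℤ) • frameA.transpose)

theorem liftGen_mul_frame : liftGen * frame = (5 : ℤ) • latticeGen := by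
  have h1 : frameA + -(gen * frameB.transpose) = (5 : ℤ) • latticeGenA := by decide +kernel
  have h2 : frameB + gen * frameA.transpose = (5 : ℤ) • latticeGenB := by decide +kernel
  rw [liftGen, frame, Matrix.fromBlocks_multiply, latticeGen, Matrix.fromBlocks_smul]
  simp [h1, h2, ← mul_assoc]
  norm_num

theorem latticeGen_mem (i) : latticeGen i ∈ lattice := by
  have h1 : ∀ i j, 2 ∣ latticeGen i j - latticeGen i (Sum.inl 0) := by decide +kernel
  have h2 : ∀ i, 4 ∣ ∑ j, latticeGen i j - 2 * latticeGen i (Sum.inl 0) := by decide +kernel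
  have h3 : ∀ i, mod₃ (latticeGen i) = encode conf₃ (mod₃ (latticeGen i) ∘ Sum.inl) := by
    have hA : (latticeGenA.map Int.cast : Matrix _ _ (ZMod 3)) * conf₃ =
        latticeGenB.map Int.cast := by decide +kernel
    have hB : (((-2 : ℤ) • frameB.transpose).map Int.cast : Matrix _ _ (ZMod 3)) * conf₃ =
        ((2 : ℤ) • frameA.transpose).map Int.cast := by decide +kernel
    rintro (i | i) <;> ext (j | j)
    · rfl
    · exact (congrFun₂ hA i j).symm
    · rfl
    · exact (congrFun₂ hB i j).symm
  exact ⟨h1 i, h2 i, h3 i⟩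

theorem natCast_euclWt {ι : Type*} [Fintype ι] (x : ι → ZMod 10) :
    (euclWt x : ℤ) = (fun i => (x i).valMinAbs) ⬝ᵥ fun i => (x i).valMinAbs := by
  have h : ∀ a : ZMod 10, ((min (a.val ^ 2) ((10 - a.val) ^ 2) : ℕ) : ℤ) =
      a.valMinAbs * a.valMinAbs := by decide
  simp only [euclWt, Nat.cast_sum, h, dotProduct]

theorem exists_mem_lattice (u : Fin 24 → ZMod 10) :
    ∃ y ∈ lattice, 5 * (y ⬝ᵥ y) = 6 * euclWt (encode gen₁₀ u) := by
  set x : Fin 24 ⊕ Fin 24 → ℤ := fun i => (encode gen₁₀ u i).valMinAbs with hx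
  have hk (j : Fin 24) : (10 : ℤ) ∣ x (Sum.inr j) - ((x ∘ Sum.inl) ᵥ* gen) j := by
    refine (ZMod.intCast_zmod_eq_zero_iff_dvd _ 10).1 ?_
    simp [hx, encode_apply, Matrix.vecMul, dotProduct, gen₁₀]
  choose k hk using hk
  have hxk : x = Sum.elim (x ∘ Sum.inl) k ᵥ* liftGen := by
    rw [liftGen, Matrix.vecMul_fromBlocks]
    ext (i | i)
    · simp
    · simp only [Sum.elim_comp_inl, Sum.elim_comp_inr, Sum.elim_inr, Pi.add_apply,
        Matrix.vecMul_smul, Matrix.vecMul_one, Pi.smul_apply, smul_eq_mul]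
      linarith [hk i]
  refine ⟨Sum.elim (x ∘ Sum.inl) k ᵥ* latticeGen, ?_, ?_⟩
  · rw [Matrix.vecMul_eq_sum]
    exact sum_mem fun i _ => zsmul_mem (latticeGen_mem i) _
  · rw [natCast_euclWt, ← hx]
    have h5 : x ᵥ* frame = (5 : ℤ) • (Sum.elim (x ∘ Sum.inl) k ᵥ* latticeGen) := by
      conv_lhs => rw [hxk]
      rw [Matrix.vecMul_vecMul, liftGen_mul_frame, Matrix.vecMul_smul]
    have h30 : x ᵥ* frame ⬝ᵥ x ᵥ* frame = 30 * (x ⬝ᵥ x) := by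
      rw [← Matrix.dotProduct_mulVec, Matrix.mulVec_vecMul, frame_mul_transpose,
        Matrix.smul_mulVec, Matrix.one_mulVec, dotProduct_smul, smul_eq_mul]
    rw [h5, smul_dotProduct, dotProduct_smul] at h30
    simp only [smul_eq_mul] at h30
    linarith

theorem twenty_dvd_euclWt (u : Fin 24 → ZMod 10) : 20 ∣ euclWt (encode gen₁₀ u) := by
  obtain ⟨y, hy, h⟩ := exists_mem_lattice u
  have := twentyfour_dvd_dotProduct_self hy
  omega

theorem sixty_le_euclWt {u : Fin 24 → ZMod 10} (hu : encode gen₁₀ u ≠ 0) :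
    60 ≤ euclWt (encode gen₁₀ u) := by
  obtain ⟨y, hy, h⟩ := exists_mem_lattice u
  have hy0 : y ≠ 0 := by
    rintro rfl
    rw [zero_dotProduct, mul_zero, natCast_euclWt] at h
    have := dotProduct_self_eq_zero.1 ((mul_eq_zero.1 h.symm).resolve_left (by decide))
    exact hu (funext fun i => (ZMod.valMinAbs_eq_zero _).1 (congrFun this i))
  have := le_dotProduct_self hy hy0
  omega

theorem exists_typeII_Z10 : ∃ C : Submodule (ZMod (2 * 5)) (Fin 24 ⊕ Fin 24 → ZMod (2 * 5)),
    IsTypeII 5 C ∧ minEuclWt C = 60 := by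
  refine ⟨LinearMap.range (encode gen₁₀), ⟨Set.ext fun x => ⟨?_, ?_⟩, ?_⟩, ?_⟩
  · rintro ⟨u, rfl⟩ - ⟨v, rfl⟩
    exact encode_dotProduct_encode gen₁₀_mul_transpose u v
  · intro hx
    obtain ⟨v, hv⟩ := exists_eq_encode gen₁₀_mul_transpose fun u => hx _ ⟨u, rfl⟩
    exact ⟨v, hv.symm⟩
  · rintro - ⟨u, rfl⟩
    exact twenty_dvd_euclWt u
  · refine IsLeast.csInf_eq ⟨?_, ?_⟩
    · refine ⟨_, ⟨![2, 2, 1, 1, 2, 1, 1, 2, 0, -2, 0, 1, 0, 1, 0, -2, -2, -2, 0, 0, 0, 1, 1, 0],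
        rfl⟩, fun h => ?_, by decide +kernel⟩
      exact absurd (congrFun h (Sum.inl 0)) (by decide)
    · rintro - ⟨-, ⟨u, rfl⟩, hu, rfl⟩
      exact sixty_le_euclWt hu

theorem euclWt_comp {m : ℕ} {ι κ : Type*} [Fintype ι] [Fintype κ] (e : ι ≃ κ)
    (x : κ → ZMod m) : euclWt (x ∘ e) = euclWt x :=
  Equiv.sum_comp e fun i => min ((x i).val ^ 2) ((m - (x i).val) ^ 2)

/-- Type II codes and their minimum weights may be transported along a bijection of coordinates. -/
theorem IsTypeII.reindex {k : ℕ} {ι κ : Type*} [Fintype ι] [Fintype κ] (e : ι ≃ κ)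
    {C : Submodule (ZMod (2 * k)) (ι → ZMod (2 * k))} (hC : IsTypeII k C) :
    ∃ D : Submodule (ZMod (2 * k)) (κ → ZMod (2 * k)),
      IsTypeII k D ∧ minEuclWt D = minEuclWt C := by
  refine ⟨C.comap (LinearMap.funLeft _ _ e), ⟨Set.ext fun x => ?_, fun x hx => ?_⟩, ?_⟩
  · have h := Set.ext_iff.1 hC.1 (x ∘ e)
    refine Iff.trans h ⟨fun hx y hy => ?_, fun hx y hy => ?_⟩
    · rw [← Equiv.sum_comp e]
      exact hx _ hy
    · have := hx (y ∘ e.symm) (by simpa [Function.comp_assoc, LinearMap.funLeft] using hy)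
      rw [← Equiv.sum_comp e] at this
      simpa using this
  · rw [← euclWt_comp e]
    exact hC.2 _ hx
  · refine congrArg sInf (Set.ext fun w => ⟨?_, ?_⟩)
    · rintro ⟨x, hx, h0, rfl⟩
      refine ⟨x ∘ e, hx, fun h => h0 ?_, euclWt_comp e x⟩
      ext i
      simpa using congrFun h (e.symm i)
    · rintro ⟨x, hx, h0, rfl⟩
      refine ⟨x ∘ e.symm, by simpa [Function.comp_assoc, LinearMap.funLeft] using hx,
        fun h => h0 ?_, euclWt_comp e.symm x⟩
      ext i
      simpa using congrFun h (e i)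

/-- an extremal Type II ℤ₁₀-code of length 48. -/
theorem exists_extremal_typeII_Z10_length_48 :
    ∃ C : Submodule (ZMod (2 * 5)) (Fin 48 → ZMod (2 * 5)),
      IsTypeII 5 C ∧ minEuclWt C = 4 * 5 * (48 / 24) + 4 * 5 ∧ minEuclWt C = 60 := by
  obtain ⟨C, hC, hmin⟩ := exists_typeII_Z10
  obtain ⟨D, hD, hDC⟩ := hC.reindex (finSumFinEquiv : Fin 24 ⊕ Fin 24 ≃ Fin 48)
  rw [hmin] at hDC
  exact ⟨D, hD, hDC, hDC⟩
end
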